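/- (Weighted Caffarelli–Kohn–Nirenberg inequality for the Grushin gradient: sufficiency.) Let p, q, r, a, α, β, σ be real numbers with 1 < p < Q, q ≥ 1, r > 0, 0 ≤ a ≤ 1, and set γ = aσ + (1−a)β. Assume d + μ(α−γ)r > 0, d + μ(α−β)q > 0, αp + Q > 0, βq + Q > 0, γr + Q > 0, the dimensional balance 1/r + γ/Q = a(1/p + (α−1)/Q) + (1−a)(1/q + β/Q), that σ ≤ α whenever a > 0, and that α − σ ≤ 1 whenever a > 0 and 1/p + (α−1)/Q = 1/r + γ/Q. Then there exists a constant C > 0 such that for every u ∈ C_0^∞(ℝ^{d+k}): (∫_{ℝ^{d+k}} (|x|^μ/ρ^μ)^{(α−γ)r} ρ^{γr} |u|^r dx dy)^{1/r} ≤ C (∫_{ℝ^{d+k}} ρ^{αp} |∇_μ u|^p dx dy)^{a/p} (∫_{ℝ^{d+k}} (|x|^μ/ρ^μ)^{(α−β)q} ρ^{βq} |u|^q dx dy)^{(1−a)/q}. -/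

import Mathlib

open MeasureTheory Real
open scoped RealInnerProductSpace ENNReal

/-- The anisotropic distance function `ρ(x,y) = (|x|^{2+2μ} + (1+μ)²|y|²)^{1/(2+2μ)}`. -/
noncomputable def grho (μ : ℝ) {d k : ℕ}
    (z : EuclideanSpace ℝ (Fin d) × EuclideanSpace ℝ (Fin k)) : ℝ :=
  (‖z.1‖ ^ (2 + 2 * μ) + (1 + μ) ^ 2 * ‖z.2‖ ^ 2) ^ (1 / (2 + 2 * μ))

/-- The Grushin gradient `∇_μ u = (∇_x u, |x|^μ ∇_y u)`. -/
noncomputable def gradMu (μ : ℝ) {d k : ℕ}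
    (u : EuclideanSpace ℝ (Fin d) × EuclideanSpace ℝ (Fin k) → ℝ)
    (z : EuclideanSpace ℝ (Fin d) × EuclideanSpace ℝ (Fin k)) :
    EuclideanSpace ℝ (Fin d) × EuclideanSpace ℝ (Fin k) :=
  (gradient (fun x => u (x, z.2)) z.1, (‖z.1‖ ^ μ) • gradient (fun y => u (z.1, y)) z.2)

/-- The Euclidean-type norm `((|v₁|² + |v₂|²))^{1/2}` of a pair. -/
noncomputable def pairNorm {d k : ℕ}
    (v : EuclideanSpace ℝ (Fin d) × EuclideanSpace ℝ (Fin k)) : ℝ :=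
  Real.sqrt (‖v.1‖ ^ 2 + ‖v.2‖ ^ 2)

/-- `|∇_μ u| = (|∇_x u|² + |x|^{2μ}|∇_y u|²)^{1/2}`. -/
noncomputable def gradMuNorm (μ : ℝ) {d k : ℕ}
    (u : EuclideanSpace ℝ (Fin d) × EuclideanSpace ℝ (Fin k) → ℝ)
    (z : EuclideanSpace ℝ (Fin d) × EuclideanSpace ℝ (Fin k)) : ℝ :=
  pairNorm (gradMu μ u z)

/-- The underlying space `ℝ^d × ℝ^k`. -/
abbrev GSpace (d k : ℕ) := EuclideanSpace ℝ (Fin d) × EuclideanSpace ℝ (Fin k)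

section Gradient

variable {d k : ℕ} {μ : ℝ}

lemma gradient_slice_fst {u : GSpace d k → ℝ} {z : GSpace d k} (hu : DifferentiableAt ℝ u z)
    (a : EuclideanSpace ℝ (Fin d)) :
    ⟪gradient (fun x => u (x, z.2)) z.1, a⟫ = fderiv ℝ u z (a, 0) := by
  have h : HasFDerivAt (fun x => u (x, z.2))
      ((fderiv ℝ u z).comp (ContinuousLinearMap.inl ℝ _ _)) z.1 :=
    HasFDerivAt.comp z.1 (f := fun x => (x, z.2)) hu.hasFDerivAt (hasFDerivAt_prodMk_left z.1 z.2)
  rw [gradient, InnerProductSpace.toDual_symm_apply, h.fderiv]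
  simp

lemma gradient_slice_snd {u : GSpace d k → ℝ} {z : GSpace d k} (hu : DifferentiableAt ℝ u z)
    (b : EuclideanSpace ℝ (Fin k)) :
    ⟪gradient (fun y => u (z.1, y)) z.2, b⟫ = fderiv ℝ u z (0, b) := by
  have h : HasFDerivAt (fun y => u (z.1, y))
      ((fderiv ℝ u z).comp (ContinuousLinearMap.inr ℝ _ _)) z.2 :=
    HasFDerivAt.comp z.2 (f := fun y => (z.1, y)) hu.hasFDerivAt (hasFDerivAt_prodMk_right z.1 z.2)
  rw [gradient, InnerProductSpace.toDual_symm_apply, h.fderiv]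
  simp

lemma fderiv_eq_inner_gradMu {u : GSpace d k → ℝ} {z : GSpace d k}
    (hu : DifferentiableAt ℝ u z) (a : EuclideanSpace ℝ (Fin d)) (b : EuclideanSpace ℝ (Fin k)) :
    fderiv ℝ u z (a, ‖z.1‖ ^ μ • b) = ⟪(gradMu μ u z).1, a⟫ + ⟪(gradMu μ u z).2, b⟫ := by
  have h : ((a, ‖z.1‖ ^ μ • b) : GSpace d k) = (a, 0) + (0, ‖z.1‖ ^ μ • b) := by simp
  rw [h, map_add, ← gradient_slice_fst hu, ← gradient_slice_snd hu]
  simp [gradMu, real_inner_smul_left]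

lemma gradMuNorm_nonneg (u : GSpace d k → ℝ) (z : GSpace d k) : 0 ≤ gradMuNorm μ u z :=
  Real.sqrt_nonneg _

lemma abs_fderiv_le_gradMuNorm {u : GSpace d k → ℝ} {z : GSpace d k}
    (hu : DifferentiableAt ℝ u z) (a : EuclideanSpace ℝ (Fin d)) (b : EuclideanSpace ℝ (Fin k)) :
    |fderiv ℝ u z (a, ‖z.1‖ ^ μ • b)| ≤ gradMuNorm μ u z * √(‖a‖ ^ 2 + ‖b‖ ^ 2) := by
  rw [fderiv_eq_inner_gradMu hu, gradMuNorm, pairNorm, ← Real.sqrt_mul (by positivity)]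
  apply Real.le_sqrt_of_sq_le
  have h1 := abs_real_inner_le_norm (gradMu μ u z).1 a
  have h2 := abs_real_inner_le_norm (gradMu μ u z).2 b
  have h3 := (abs_add_le ⟪(gradMu μ u z).1, a⟫ ⟪(gradMu μ u z).2, b⟫).trans (add_le_add h1 h2)
  calc _ ≤ (‖(gradMu μ u z).1‖ * ‖a‖ + ‖(gradMu μ u z).2‖ * ‖b‖) ^ 2 := by gcongr
    _ ≤ _ := by nlinarith [sq_nonneg (‖(gradMu μ u z).1‖ * ‖b‖ - ‖(gradMu μ u z).2‖ * ‖a‖)]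

lemma gradMuNorm_le {u : GSpace d k → ℝ} {z : GSpace d k} (hu : DifferentiableAt ℝ u z) {M : ℝ}
    (hM : 0 ≤ M) (h : ∀ a b, |fderiv ℝ u z (a, ‖z.1‖ ^ μ • b)| ≤ M * √(‖a‖ ^ 2 + ‖b‖ ^ 2)) :
    gradMuNorm μ u z ≤ M := by
  have h1 := h (gradMu μ u z).1 (gradMu μ u z).2
  rw [fderiv_eq_inner_gradMu hu, real_inner_self_eq_norm_sq, real_inner_self_eq_norm_sq,
    abs_of_nonneg (by positivity)] at h1
  rw [gradMuNorm, pairNorm]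
  set P := ‖(gradMu μ u z).1‖ ^ 2 + ‖(gradMu μ u z).2‖ ^ 2
  have hP : 0 ≤ P := by positivity
  rcases (Real.sqrt_nonneg P).eq_or_lt with h0 | h0
  · rw [← h0]; exact hM
  · nlinarith [Real.mul_self_sqrt hP]

lemma gradMuNorm_sub_le {u v : GSpace d k → ℝ} {z : GSpace d k} (hu : DifferentiableAt ℝ u z)
    (hv : DifferentiableAt ℝ v z) :
    gradMuNorm μ (fun z => u z - v z) z ≤ gradMuNorm μ u z + gradMuNorm μ v z := by
  refine gradMuNorm_le (hu.sub hv) (add_nonneg (gradMuNorm_nonneg _ _) (gradMuNorm_nonneg _ _))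
    fun a b => ?_
  rw [fderiv_sub hu hv, add_mul]
  exact (abs_sub _ _).trans
    (add_le_add (abs_fderiv_le_gradMuNorm hu a b) (abs_fderiv_le_gradMuNorm hv a b))

lemma gradMuNorm_mul_le {u v : GSpace d k → ℝ} {z : GSpace d k} (hu : DifferentiableAt ℝ u z)
    (hv : DifferentiableAt ℝ v z) :
    gradMuNorm μ (fun z => u z * v z) z ≤ |u z| * gradMuNorm μ v z + |v z| * gradMuNorm μ u z := by
  have h0 := gradMuNorm_nonneg (μ := μ) u z
  have h1 := gradMuNorm_nonneg (μ := μ) v z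
  refine gradMuNorm_le (hu.mul hv) (by positivity) fun a b => ?_
  rw [fderiv_mul hu hv, add_mul, mul_assoc, mul_assoc]
  refine (abs_add_le _ _).trans (add_le_add ?_ ?_)
  · refine (abs_mul (u z) _).trans_le ?_
    gcongr
    exact abs_fderiv_le_gradMuNorm hv a b
  · refine (abs_mul (v z) _).trans_le ?_
    gcongr
    exact abs_fderiv_le_gradMuNorm hu a b

lemma gradMuNorm_comp_le {u : GSpace d k → ℝ} {z : GSpace d k} {φ : ℝ → ℝ} {φ' : ℝ}
    (hu : DifferentiableAt ℝ u z) (hφ : HasDerivAt φ φ' (u z)) :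
    gradMuNorm μ (fun z => φ (u z)) z ≤ |φ'| * gradMuNorm μ u z := by
  have h := hφ.comp_hasFDerivAt z hu.hasFDerivAt
  have h0 := gradMuNorm_nonneg (μ := μ) u z
  refine gradMuNorm_le h.differentiableAt (by positivity) fun a b => ?_
  rw [h.fderiv, mul_assoc]
  refine (abs_mul φ' _).trans_le ?_
  gcongr
  exact abs_fderiv_le_gradMuNorm hu a b

lemma continuous_gradMuNorm (hμ : 0 < μ) {u : GSpace d k → ℝ} (hu : ContDiff ℝ 1 u) :
    Continuous (gradMuNorm μ u) := by
  have hd := hu.differentiable one_ne_zero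
  have hf : Continuous (fderiv ℝ u) := hu.continuous_fderiv one_ne_zero
  have h1 : (fun z : GSpace d k => gradient (fun x => u (x, z.2)) z.1) =
      fun z => (InnerProductSpace.toDual ℝ _).symm
        ((fderiv ℝ u z).comp (ContinuousLinearMap.inl ℝ _ _)) := by
    ext1 z
    refine ext_inner_right ℝ fun a => ?_
    rw [gradient_slice_fst (hd z), InnerProductSpace.toDual_symm_apply]
    simp
  have h2 : (fun z : GSpace d k => gradient (fun y => u (z.1, y)) z.2) =
      fun z => (InnerProductSpace.toDual ℝ _).symm
        ((fderiv ℝ u z).comp (ContinuousLinearMap.inr ℝ _ _)) := by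
    ext1 z
    refine ext_inner_right ℝ fun a => ?_
    rw [gradient_slice_snd (hd z), InnerProductSpace.toDual_symm_apply]
    simp
  have c1 : Continuous (fun z : GSpace d k => gradient (fun x => u (x, z.2)) z.1) := by
    rw [h1]; fun_prop
  have c2 : Continuous (fun z : GSpace d k => gradient (fun y => u (z.1, y)) z.2) := by
    rw [h2]; fun_prop
  have c3 : Continuous (fun z : GSpace d k => ‖z.1‖ ^ μ) :=
    continuous_fst.norm.rpow_const fun _ => Or.inr hμ.le
  exact Real.continuous_sqrt.comp ((c1.norm.pow 2).add ((c3.smul c2).norm.pow 2))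

end Gradient

section Dilation

variable {d k : ℕ} {μ : ℝ}

/-- The dilation `(x, y) ↦ (τ x, τ^ν y)`. -/
noncomputable def dil (ν τ : ℝ) {d k : ℕ} (z : GSpace d k) : GSpace d k :=
  (τ • z.1, τ ^ ν • z.2)

/-- The linear homeomorphism underlying `dil ν τ`. -/
noncomputable def dilEquiv (ν τ : ℝ) (hτ : 0 < τ) (d k : ℕ) : GSpace d k ≃L[ℝ] GSpace d k :=
  (ContinuousLinearEquiv.smulLeft (Units.mk0 τ hτ.ne')).prodCongr
    (ContinuousLinearEquiv.smulLeft (Units.mk0 (τ ^ ν) (rpow_pos_of_pos hτ ν).ne'))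

lemma dil_one (ν : ℝ) (z : GSpace d k) : dil ν 1 z = z := by simp [dil]

lemma ContDiff.comp_dil {u : GSpace d k → ℝ} (hu : ContDiff ℝ 1 u) {ν τ : ℝ} (hτ : 0 < τ) :
    ContDiff ℝ 1 (fun z => u (dil ν τ z)) :=
  hu.comp (dilEquiv ν τ hτ d k).contDiff

lemma HasCompactSupport.comp_dil {u : GSpace d k → ℝ} (hu : HasCompactSupport u) {ν τ : ℝ}
    (hτ : 0 < τ) : HasCompactSupport (fun z => u (dil ν τ z)) :=
  hu.comp_homeomorph (dilEquiv ν τ hτ d k).toHomeomorph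

lemma lintegral_comp_dil {ν τ : ℝ} (hτ : 0 < τ) (g : GSpace d k → ℝ≥0∞) :
    ∫⁻ z, g (dil ν τ z) = ENNReal.ofReal (τ ^ (-(d + ν * k))) * ∫⁻ z, g z := by
  have hm : (volume : Measure (GSpace d k)).map (dil ν τ) =
      ENNReal.ofReal (τ ^ (-(d + ν * k))) • volume := by
    have h1 : Measurable (fun x : EuclideanSpace ℝ (Fin d) => τ • x) := by fun_prop
    have h2 : Measurable (fun x : EuclideanSpace ℝ (Fin k) => τ ^ ν • x) := by fun_prop
    have e : (dil ν τ : GSpace d k → GSpace d k) =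
      Prod.map (fun x => τ • x) (fun x => τ ^ ν • x) := rfl
    have h3 : |(τ ^ d)⁻¹| = τ ^ (-(d : ℝ)) := by
      rw [abs_of_pos (by positivity), rpow_neg hτ.le, rpow_natCast]
    have h4 : |((τ ^ ν) ^ k)⁻¹| = τ ^ (-(ν * k)) := by
      rw [abs_of_pos (by positivity), rpow_neg hτ.le, rpow_mul hτ.le, rpow_natCast]
    rw [e, Measure.volume_eq_prod, ← Measure.map_prod_map _ _ h1 h2,
      Measure.map_addHaar_smul _ hτ.ne', Measure.map_addHaar_smul _ (rpow_pos_of_pos hτ ν).ne',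
      finrank_euclideanSpace_fin, finrank_euclideanSpace_fin, h3, h4, neg_add, rpow_add hτ,
      ENNReal.ofReal_mul (by positivity), Measure.prod_smul_left, Measure.prod_smul_right,
      smul_smul]
  refine ((dilEquiv ν τ hτ d k).toHomeomorph.measurableEmbedding.lintegral_map g
    (μ := volume)).symm.trans ?_
  change ∫⁻ z, g z ∂((volume : Measure (GSpace d k)).map (dil ν τ)) = _
  rw [hm, lintegral_smul_measure, smul_eq_mul]

lemma fderiv_comp_dil {u : GSpace d k → ℝ} {ν τ : ℝ} (hτ : 0 < τ) {z : GSpace d k}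
    (hu : DifferentiableAt ℝ u (dil ν τ z)) (w : GSpace d k) :
    fderiv ℝ (fun z => u (dil ν τ z)) z w = fderiv ℝ u (dil ν τ z) (dil ν τ w) := by
  have h : HasFDerivAt (fun z => u (dil ν τ z))
      ((fderiv ℝ u (dil ν τ z)).comp (dilEquiv ν τ hτ d k : GSpace d k →L[ℝ] GSpace d k)) z :=
    HasFDerivAt.comp z (f := dil ν τ) hu.hasFDerivAt (dilEquiv ν τ hτ d k).hasFDerivAt
  rw [h.fderiv]; rfl

lemma gradMuNorm_comp_dil_le {u : GSpace d k → ℝ} {ν τ : ℝ} (hτ : 1 ≤ τ) (hν : ν ≤ 1 + μ)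
    {z : GSpace d k} (hu : DifferentiableAt ℝ u (dil ν τ z)) :
    gradMuNorm μ (fun z => u (dil ν τ z)) z ≤ τ * gradMuNorm μ u (dil ν τ z) := by
  have hτ0 : 0 < τ := by linarith
  have h0 := gradMuNorm_nonneg (μ := μ) u (dil ν τ z)
  refine gradMuNorm_le (hu.comp z (dilEquiv ν τ hτ0 d k).differentiableAt) (by positivity)
    fun a b => ?_
  have e0 := fderiv_comp_dil hτ0 hu (a, ‖z.1‖ ^ μ • b)
  have e : dil ν τ ((a, ‖z.1‖ ^ μ • b) : GSpace d k) =
      (τ • a, ‖(dil ν τ z).1‖ ^ μ • (τ ^ (ν - μ) • b)) := by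
    have : τ ^ ν * ‖z.1‖ ^ μ = (τ * ‖z.1‖) ^ μ * τ ^ (ν - μ) := by
      rw [mul_rpow hτ0.le (norm_nonneg _), rpow_sub hτ0]
      have := (rpow_pos_of_pos hτ0 μ).ne'
      field_simp
    simp [dil, norm_smul, abs_of_pos hτ0, smul_smul, this]
  rw [e] at e0
  refine (congrArg abs e0).trans_le ((abs_fderiv_le_gradMuNorm hu _ _).trans ?_)
  rw [mul_comm τ, mul_assoc]
  gcongr
  apply Real.sqrt_le_iff.2 ⟨by positivity, ?_⟩
  rw [mul_pow, Real.sq_sqrt (by positivity), norm_smul, norm_smul, Real.norm_of_nonneg hτ0.le,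
    Real.norm_of_nonneg (by positivity), mul_pow, mul_pow, mul_add]
  gcongr
  calc τ ^ (ν - μ) ≤ τ ^ (1 : ℝ) := rpow_le_rpow_of_exponent_le hτ (by linarith)
    _ = τ := rpow_one τ

end Dilation

section Shift

variable {d k : ℕ}

lemma ENNReal.rpow_le_two_rpow_mul_add {x y y' : ℝ≥0∞} (h : x ≤ y + y') {r : ℝ} (hr : 0 ≤ r) :
    x ^ r ≤ 2 ^ r * (y ^ r + y' ^ r) := by
  rcases le_total y y' with h1 | h1
  · calc x ^ r ≤ (2 * y') ^ r := by
          gcongr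
          calc x ≤ y + y' := h
            _ ≤ y' + y' := by gcongr
            _ = 2 * y' := (two_mul _).symm
      _ = 2 ^ r * y' ^ r := ENNReal.mul_rpow_of_nonneg _ _ hr
      _ ≤ _ := by gcongr; exact le_add_self
  · calc x ^ r ≤ (2 * y) ^ r := by
          gcongr
          calc x ≤ y + y' := h
            _ ≤ y + y := by gcongr
            _ = 2 * y := (two_mul _).symm
      _ = 2 ^ r * y ^ r := ENNReal.mul_rpow_of_nonneg _ _ hr
      _ ≤ _ := by gcongr; exact le_self_add

lemma ENNReal.lintegral_rpow_le_two_rpow_mul {α : Type*} [MeasurableSpace α] {m : Measure α}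
    {f g g' : α → ℝ≥0∞} (h : ∀ z, f z ≤ g z + g' z) (hg : Measurable g) {r : ℝ} (hr : 0 ≤ r) :
    ∫⁻ z, f z ^ r ∂m ≤ 2 ^ r * (∫⁻ z, g z ^ r ∂m + ∫⁻ z, g' z ^ r ∂m) := by
  rw [← lintegral_add_left (hg.pow_const r), ← lintegral_const_mul' _ _ (by finiteness)]
  exact lintegral_mono fun z => ENNReal.rpow_le_two_rpow_mul_add (h z) hr

lemma lintegral_weight_comp_dil {ν τ t r : ℝ} (hτ : 0 < τ) (hr : 0 ≤ r) {W : GSpace d k → ℝ}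
    (hWh : ∀ z, W (dil ν τ z) = τ ^ t * W z) (v : GSpace d k → ℝ) :
    ∫⁻ z, ENNReal.ofReal (W z * v (dil ν τ z)) ^ r =
      ENNReal.ofReal (τ ^ (-(d + ν * k + t * r))) * ∫⁻ z, ENNReal.ofReal (W z * v z) ^ r := by
  have h1 : ∀ z, ENNReal.ofReal (W z * v (dil ν τ z)) ^ r =
      ENNReal.ofReal (τ ^ (-(t * r))) *
        ENNReal.ofReal (W (dil ν τ z) * v (dil ν τ z)) ^ r := by
    intro z
    rw [show -(t * r) = -t * r by ring, rpow_mul hτ.le,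
      ← ENNReal.ofReal_rpow_of_nonneg (by positivity) hr, ← ENNReal.mul_rpow_of_nonneg _ _ hr,
      ← ENNReal.ofReal_mul (by positivity), hWh, rpow_neg hτ.le]
    have := (rpow_pos_of_pos hτ t).ne'
    congr 2
    field_simp
  simp_rw [h1]
  rw [lintegral_const_mul' _ _ ENNReal.ofReal_ne_top,
    lintegral_comp_dil hτ (fun z => ENNReal.ofReal (W z * v z) ^ r), ← mul_assoc,
    ← ENNReal.ofReal_mul (by positivity), ← rpow_add hτ]
  congr 3
  ring

/-- A weighted norm that contracts under a dilation is controlled by the difference of a function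
and its dilate. -/
lemma lintegral_le_lintegral_sub_comp_dil {ν τ t r : ℝ} (hτ : 0 < τ) (hr : 0 < r)
    (hlarge : 2 ^ (r + 1) ≤ τ ^ (d + ν * k + t * r)) {W : GSpace d k → ℝ} (hW : ∀ z, 0 ≤ W z)
    (hWm : Measurable W) (hWh : ∀ z, W (dil ν τ z) = τ ^ t * W z) {v : GSpace d k → ℝ}
    (hv : Continuous v) (hfin : ∫⁻ z, ENNReal.ofReal (W z * |v z|) ^ r ≠ ∞) :
    ∫⁻ z, ENNReal.ofReal (W z * |v z|) ^ r ≤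
      2 ^ (r + 1) * ∫⁻ z, ENNReal.ofReal (W z * |v z - v (dil ν τ z)|) ^ r := by
  have hvT : Continuous fun z => v (dil ν τ z) := hv.comp (dilEquiv ν τ hτ d k).continuous
  have h1 := ENNReal.lintegral_rpow_le_two_rpow_mul (m := volume) (r := r)
    (f := fun z => ENNReal.ofReal (W z * |v z|))
    (g := fun z => ENNReal.ofReal (W z * |v z - v (dil ν τ z)|))
    (g' := fun z => ENNReal.ofReal (W z * |v (dil ν τ z)|)) (fun z => by
      have h0 := hW z
      rw [← ENNReal.ofReal_add (by positivity) (by positivity), ← mul_add]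
      apply ENNReal.ofReal_le_ofReal
      gcongr
      calc |v z| = |(v z - v (dil ν τ z)) + v (dil ν τ z)| := by ring_nf
        _ ≤ _ := abs_add_le _ _)
    (hWm.mul (hv.sub hvT).abs.measurable).ennreal_ofReal hr.le
  rw [lintegral_weight_comp_dil hτ hr.le hWh (fun z => |v z|)] at h1
  set S := ∫⁻ z, ENNReal.ofReal (W z * |v z|) ^ r
  set D := ∫⁻ z, ENNReal.ofReal (W z * |v z - v (dil ν τ z)|) ^ r
  have h2 : 2 ^ r * ENNReal.ofReal (τ ^ (-(d + ν * k + t * r))) ≤ (2 : ℝ≥0∞)⁻¹ := by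
    have e1 : (2 : ℝ≥0∞) ^ r = ENNReal.ofReal (2 ^ r) := by
      rw [← ENNReal.ofReal_rpow_of_pos two_pos]; simp
    have e2 : (2 : ℝ≥0∞)⁻¹ = ENNReal.ofReal (2⁻¹) := by
      rw [ENNReal.ofReal_inv_of_pos two_pos]; simp
    rw [e1, e2, ← ENNReal.ofReal_mul (by positivity)]
    apply ENNReal.ofReal_le_ofReal
    rw [rpow_neg hτ.le, ← div_eq_mul_inv, div_le_iff₀ (by positivity)]
    rw [rpow_add two_pos, rpow_one] at hlarge
    linarith
  have h3 : S ≤ 2 ^ r * D + S / 2 := by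
    calc S ≤ _ := h1
      _ = 2 ^ r * D + (2 ^ r * ENNReal.ofReal (τ ^ (-(d + ν * k + t * r)))) * S := by ring
      _ ≤ 2 ^ r * D + 2⁻¹ * S := by gcongr
      _ = _ := by rw [mul_comm, ENNReal.div_eq_inv_mul, mul_comm]
  have h4 : S / 2 ≤ 2 ^ r * D := by
    have h5 : S / 2 + S / 2 ≤ 2 ^ r * D + S / 2 := by rwa [ENNReal.add_halves]
    exact ENNReal.le_of_add_le_add_right (ENNReal.div_ne_top hfin two_ne_zero) h5
  calc S = 2 * (S / 2) := (ENNReal.mul_div_cancel two_ne_zero ENNReal.ofNat_ne_top).symm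
    _ ≤ 2 * (2 ^ r * D) := by gcongr
    _ = _ := by
      rw [ENNReal.rpow_add _ _ two_ne_zero ENNReal.ofNat_ne_top, ENNReal.rpow_one]; ring

/-- The derivative along the generator of the dilations `dil ν`. -/
noncomputable def eulerDeriv (ν : ℝ) (v : GSpace d k → ℝ) (z : GSpace d k) : ℝ :=
  fderiv ℝ v z (z.1, ν • z.2)

lemma continuous_eulerDeriv (ν : ℝ) {v : GSpace d k → ℝ} (hv : ContDiff ℝ 1 v) :
    Continuous (eulerDeriv ν v) := by
  have hf : Continuous (fderiv ℝ v) := hv.continuous_fderiv one_ne_zero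
  exact hf.clm_apply (by fun_prop)

lemma hasDerivAt_comp_dil {ν τ : ℝ} (hτ : 0 < τ) {v : GSpace d k → ℝ} (hv : Differentiable ℝ v)
    (z : GSpace d k) :
    HasDerivAt (fun τ => v (dil ν τ z)) (τ⁻¹ * eulerDeriv ν v (dil ν τ z)) τ := by
  have h1 : HasDerivAt (fun τ => dil ν τ z) (z.1, (ν * τ ^ (ν - 1)) • z.2) τ := by
    have ha : HasDerivAt (fun τ : ℝ => τ • z.1) z.1 τ := by
      simpa using (hasDerivAt_id τ).smul_const z.1
    have hb : HasDerivAt (fun τ : ℝ => τ ^ ν • z.2) ((ν * τ ^ (ν - 1)) • z.2) τ :=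
      (Real.hasDerivAt_rpow_const (Or.inl hτ.ne')).smul_const z.2
    exact ha.prodMk hb
  have h2 := (hv (dil ν τ z)).hasFDerivAt.comp_hasDerivAt τ h1
  convert! h2 using 1
  rw [eulerDeriv, ← smul_eq_mul, ← map_smul]
  congr 1
  ext1
  · simp [dil, smul_smul, hτ.ne']
  · simp only [dil, Prod.smul_mk, smul_smul]
    rw [rpow_sub_one hτ.ne']
    congr 1
    ring

lemma ofReal_abs_sub_comp_dil_le {ν l : ℝ} (hl : 1 ≤ l) {v : GSpace d k → ℝ}
    (hv : ContDiff ℝ 1 v) (z : GSpace d k) :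
    ENNReal.ofReal |v z - v (dil ν l z)| ≤
      ∫⁻ τ in Set.Ioc 1 l, ENNReal.ofReal |eulerDeriv ν v (dil ν τ z)| := by
  have hd := hv.differentiable one_ne_zero
  have hpos : ∀ τ ∈ Set.uIcc 1 l, (0 : ℝ) < τ := fun τ hτ => by
    rw [Set.uIcc_of_le hl] at hτ; linarith [hτ.1]
  have hc : ContinuousOn (fun τ : ℝ => τ⁻¹ * eulerDeriv ν v (dil ν τ z)) (Set.uIcc 1 l) := by
    refine ContinuousOn.mul (continuousOn_id.inv₀ fun τ hτ => (hpos τ hτ).ne') ?_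
    refine (continuous_eulerDeriv ν hv).comp_continuousOn ?_
    refine ContinuousOn.prodMk (by fun_prop) ?_
    exact (continuousOn_id.rpow_const fun τ hτ => Or.inl (hpos τ hτ).ne').smul continuousOn_const
  have h := intervalIntegral.integral_eq_sub_of_hasDerivAt
    (fun τ hτ => hasDerivAt_comp_dil (ν := ν) (hpos τ hτ) hd z) hc.intervalIntegrable
  rw [dil_one] at h
  rw [abs_sub_comm, ← h, intervalIntegral.integral_of_le hl, ← Real.norm_eq_abs,
    ofReal_norm]
  refine (enorm_integral_le_lintegral_enorm _).trans ?_
  refine setLIntegral_mono' measurableSet_Ioc fun τ hτ => ?_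
  rw [← ofReal_norm, Real.norm_eq_abs, abs_mul]
  apply ENNReal.ofReal_le_ofReal
  have h1 : |τ⁻¹| ≤ 1 := by
    rw [abs_of_pos (inv_pos.2 (by linarith [hτ.1]))]
    exact inv_le_one_of_one_le₀ hτ.1.le
  exact mul_le_of_le_one_left (abs_nonneg _) h1

lemma lintegral_rpow_le_const_mul_lintegral_rpow {α : Type*} [MeasurableSpace α] {m : Measure α}
    {f : α → ℝ≥0∞} (hf : AEMeasurable f m) {p : ℝ} (hp : 1 ≤ p) :
    (∫⁻ x, f x ∂m) ^ p ≤ m Set.univ ^ (p - 1) * ∫⁻ x, f x ^ p ∂m := by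
  rcases hp.eq_or_lt with rfl | hp
  · simp
  have h := ENNReal.lintegral_mul_le_Lp_mul_Lq m (Real.HolderConjugate.conjExponent hp) hf
    (aemeasurable_const (b := 1))
  have hp0 : 0 < p := by linarith
  calc (∫⁻ x, f x ∂m) ^ p
      ≤ ((∫⁻ x, f x ^ p ∂m) ^ (1 / p) * (m Set.univ) ^ (1 / p.conjExponent)) ^ p := by
        gcongr; simpa using h
    _ = _ := by
        rw [ENNReal.mul_rpow_of_nonneg _ _ hp0.le, ← ENNReal.rpow_mul, ← ENNReal.rpow_mul,
          one_div_mul_cancel hp0.ne', ENNReal.rpow_one, mul_comm]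
        congr 2
        rw [Real.conjExponent]
        field_simp

lemma exists_lintegral_sub_comp_dil_le {ν l t p : ℝ} (hl : 1 ≤ l) (hp : 1 ≤ p)
    {W : GSpace d k → ℝ} (hW : ∀ z, 0 ≤ W z) (hWm : Measurable W)
    (hWh : ∀ τ, 0 < τ → ∀ z, W (dil ν τ z) = τ ^ t * W z) :
    ∃ C : ℝ≥0∞, C ≠ ∞ ∧ ∀ v : GSpace d k → ℝ, ContDiff ℝ 1 v →
      ∫⁻ z, ENNReal.ofReal (W z * |v z - v (dil ν l z)|) ^ p ≤
        C * ∫⁻ z, ENNReal.ofReal (W z * |eulerDeriv ν v z|) ^ p := by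
  have hp0 : 0 ≤ p := by linarith
  refine ⟨ENNReal.ofReal (l - 1) ^ (p - 1) *
    (ENNReal.ofReal (l ^ |d + ν * k + t * p|) * ENNReal.ofReal (l - 1)),
    by have : 0 ≤ p - 1 := by linarith
       finiteness, fun v hv => ?_⟩
  set K := ∫⁻ z, ENNReal.ofReal (W z * |eulerDeriv ν v z|) ^ p
  have hmeas : Measurable fun w : GSpace d k × ℝ =>
      ENNReal.ofReal (W w.1 * |eulerDeriv ν v (dil ν w.2 w.1)|) := by
    have h1 : Measurable fun w : GSpace d k × ℝ => dil ν w.2 w.1 := by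
      unfold dil; fun_prop
    have h2 := (continuous_eulerDeriv ν hv).measurable.comp h1
    have h3 : Measurable fun w : GSpace d k × ℝ => |eulerDeriv ν v (dil ν w.2 w.1)| :=
      continuous_abs.measurable.comp h2
    fun_prop
  calc ∫⁻ z, ENNReal.ofReal (W z * |v z - v (dil ν l z)|) ^ p
      ≤ ∫⁻ z, (∫⁻ τ in Set.Ioc 1 l,
          ENNReal.ofReal (W z * |eulerDeriv ν v (dil ν τ z)|)) ^ p := by
        refine lintegral_mono fun z => ?_
        dsimp only
        gcongr
        simp_rw [ENNReal.ofReal_mul (hW z)]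
        rw [lintegral_const_mul' _ _ ENNReal.ofReal_ne_top]
        gcongr
        exact ofReal_abs_sub_comp_dil_le hl hv z
    _ ≤ ∫⁻ z, ENNReal.ofReal (l - 1) ^ (p - 1) * ∫⁻ τ in Set.Ioc 1 l,
          ENNReal.ofReal (W z * |eulerDeriv ν v (dil ν τ z)|) ^ p := by
        refine lintegral_mono fun z => ?_
        refine (lintegral_rpow_le_const_mul_lintegral_rpow
          (hmeas.comp measurable_prodMk_left).aemeasurable hp).trans_eq ?_
        simp
    _ = ENNReal.ofReal (l - 1) ^ (p - 1) * ∫⁻ τ in Set.Ioc 1 l, ∫⁻ z,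
          ENNReal.ofReal (W z * |eulerDeriv ν v (dil ν τ z)|) ^ p := by
        rw [lintegral_const_mul' _ _ (by have : 0 ≤ p - 1 := by linarith
                                         finiteness)]
        congr 1
        exact lintegral_lintegral_swap (hmeas.pow_const p).aemeasurable
    _ ≤ ENNReal.ofReal (l - 1) ^ (p - 1) * ∫⁻ τ in Set.Ioc 1 l,
          ENNReal.ofReal (l ^ |d + ν * k + t * p|) * K := by
        refine mul_le_mul_right ?_ _
        refine setLIntegral_mono' measurableSet_Ioc fun τ hτ => ?_
        have hτ0 : 0 < τ := by linarith [hτ.1]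
        rw [lintegral_weight_comp_dil hτ0 hp0 (hWh τ hτ0) (fun z => |eulerDeriv ν v z|)]
        gcongr
        calc τ ^ (-(d + ν * k + t * p)) ≤ τ ^ |d + ν * k + t * p| :=
              Real.rpow_le_rpow_of_exponent_le (le_of_lt (show (1 : ℝ) < τ from hτ.1))
                (neg_le_abs _)
          _ ≤ _ := rpow_le_rpow hτ0.le hτ.2 (abs_nonneg _)
    _ = _ := by
        rw [lintegral_const, Measure.restrict_apply_univ, Real.volume_Ioc]
        ring

end Shift

section Grid

variable {d k : ℕ} {μ : ℝ}

/-- The coordinates on `ℝ^d × ℝ^k`. -/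
noncomputable def coordEquiv (d k : ℕ) : (Fin d ⊕ Fin k → ℝ) ≃L[ℝ] GSpace d k :=
  ((LinearEquiv.sumArrowLequivProdArrow (Fin d) (Fin k) ℝ ℝ).trans
    ((WithLp.linearEquiv 2 ℝ (Fin d → ℝ)).symm.prodCongr
      (WithLp.linearEquiv 2 ℝ (Fin k → ℝ)).symm)).toContinuousLinearEquiv

lemma measurePreserving_coordEquiv : MeasurePreserving (coordEquiv d k) := by
  have h := ((PiLp.volume_preserving_toLp (Fin d)).prod (PiLp.volume_preserving_toLp (Fin k))).comp
    (volume_measurePreserving_sumPiEquivProdPi fun _ : Fin d ⊕ Fin k => ℝ)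
  exact h

lemma coordEquiv_single_inl (i : Fin d) :
    coordEquiv d k (Pi.single (Sum.inl i) 1) = (EuclideanSpace.single i 1, 0) := by
  ext j
  · change (Pi.single (Sum.inl i) 1 : Fin d ⊕ Fin k → ℝ) (Sum.inl j) = _
    simp [Pi.single_apply]
  · change (Pi.single (Sum.inl i) 1 : Fin d ⊕ Fin k → ℝ) (Sum.inr j) = _
    simp

lemma coordEquiv_single_inr (i : Fin k) :
    coordEquiv d k (Pi.single (Sum.inr i) 1) = (0, EuclideanSpace.single i 1) := by
  ext j
  · change (Pi.single (Sum.inr i) 1 : Fin d ⊕ Fin k → ℝ) (Sum.inl j) = _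
    simp
  · change (Pi.single (Sum.inr i) 1 : Fin d ⊕ Fin k → ℝ) (Sum.inr j) = _
    simp [Pi.single_apply]

lemma coordEquiv_update_inr_fst (f : Fin d ⊕ Fin k → ℝ) (i : Fin k) (t : ℝ) :
    (coordEquiv d k (Function.update f (Sum.inr i) t)).1 = (coordEquiv d k f).1 := by
  ext j
  change Function.update f (Sum.inr i) t (Sum.inl j) = f (Sum.inl j)
  simp

lemma enorm_le_lintegral_deriv_update {v : GSpace d k → ℝ} (hv : ContDiff ℝ 1 v)
    (hvc : HasCompactSupport v) (f : Fin d ⊕ Fin k → ℝ) (i : Fin d ⊕ Fin k) :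
    ENNReal.ofReal |v (coordEquiv d k f)| ≤
      ∫⁻ t, ENNReal.ofReal |fderiv ℝ v (coordEquiv d k (Function.update f i t))
        (coordEquiv d k (Pi.single i 1))| := by
  have hve : ContDiff ℝ 1 (v ∘ coordEquiv d k) := hv.comp (coordEquiv d k).contDiff
  have hvce : HasCompactSupport (v ∘ coordEquiv d k) :=
    hvc.comp_homeomorph (coordEquiv d k).toHomeomorph
  have h1 : ‖((v ∘ coordEquiv d k) ∘ Function.update f i) (f i)‖ₑ ≤
      ∫⁻ t in Set.Iic (f i), ‖deriv ((v ∘ coordEquiv d k) ∘ Function.update f i) t‖ₑ := by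
    apply HasCompactSupport.enorm_le_lintegral_Ici_deriv
    · exact hve.comp (by convert! contDiff_update 1 f i)
    · exact hvce.comp_isClosedEmbedding (isClosedEmbedding_update f i)
  have h2 : ∀ t, deriv ((v ∘ coordEquiv d k) ∘ Function.update f i) t =
      fderiv ℝ v (coordEquiv d k (Function.update f i t)) (coordEquiv d k (Pi.single i 1)) := by
    intro t
    have ha := hasDerivAt_update f i t
    have hb := (coordEquiv d k).hasFDerivAt.comp_hasDerivAt t ha
    have hc := (hv.differentiable one_ne_zero (coordEquiv d k
      (Function.update f i t))).hasFDerivAt.comp_hasDerivAt t hb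
    exact hc.deriv
  simp only [h2, Function.comp_apply, Function.update_eq_self] at h1
  simp_rw [← Real.norm_eq_abs, ofReal_norm]
  exact h1.trans (lintegral_mono' Measure.restrict_le_self le_rfl)

/-- The factor by which the `i`-th partial derivative is weighted in the Grushin gradient. -/
noncomputable def gridWeight (μ : ℝ) (f : Fin d ⊕ Fin k → ℝ) : Fin d ⊕ Fin k → ℝ≥0∞ :=
  Sum.elim 1 fun _ => ENNReal.ofReal (‖(coordEquiv d k f).1‖ ^ μ)

lemma gridWeight_mul_le {v : GSpace d k → ℝ} (hv : ContDiff ℝ 1 v)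
    (hvc : HasCompactSupport v) (f : Fin d ⊕ Fin k → ℝ) (i : Fin d ⊕ Fin k) :
    gridWeight μ f i * ENNReal.ofReal |v (coordEquiv d k f)| ≤
      ∫⁻ t, ENNReal.ofReal (gradMuNorm μ v (coordEquiv d k (Function.update f i t))) := by
  have hd := hv.differentiable one_ne_zero
  refine (mul_le_mul_right (enorm_le_lintegral_deriv_update hv hvc f i) _).trans ?_
  rw [← lintegral_const_mul' _ _ (by cases i <;> simp [gridWeight])]
  refine lintegral_mono fun t => ?_
  dsimp only
  rcases i with i | i
  · rw [coordEquiv_single_inl]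
    have h := abs_fderiv_le_gradMuNorm (μ := μ)
      (hd (coordEquiv d k (Function.update f (Sum.inl i) t))) (EuclideanSpace.single i 1) 0
    simp only [smul_zero, PiLp.norm_single, norm_one, norm_zero] at h
    simpa [gridWeight] using ENNReal.ofReal_le_ofReal (h.trans_eq (by norm_num))
  · rw [coordEquiv_single_inr]
    have h := abs_fderiv_le_gradMuNorm (μ := μ)
      (hd (coordEquiv d k (Function.update f (Sum.inr i) t))) 0 (EuclideanSpace.single i 1)
    simp only [PiLp.norm_single, norm_one, norm_zero, coordEquiv_update_inr_fst] at h
    simp only [gridWeight, Sum.elim_inr]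
    rw [← ENNReal.ofReal_mul (by positivity)]
    refine ENNReal.ofReal_le_ofReal (le_trans (le_of_eq ?_) (h.trans_eq (by norm_num)))
    rw [show ((0, ‖((coordEquiv d k) f).1‖ ^ μ • EuclideanSpace.single i (1 : ℝ)) : GSpace d k) =
      ‖((coordEquiv d k) f).1‖ ^ μ • (0, EuclideanSpace.single i 1) by simp, map_smul, smul_eq_mul,
      abs_mul, abs_of_nonneg (by positivity : 0 ≤ ‖((coordEquiv d k) f).1‖ ^ μ)]

lemma lintegral_grid_le (hd : 1 ≤ d) (hk : 1 ≤ k) (hμ : 0 < μ) {v : GSpace d k → ℝ}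
    (hv : ContDiff ℝ 1 v) (hvc : HasCompactSupport v) :
    ∫⁻ z, ENNReal.ofReal (‖z.1‖ ^ (μ * k / (d + k - 1)) *
        |v z| ^ (((d : ℝ) + k) / (d + k - 1))) ≤
      (∫⁻ z, ENNReal.ofReal (gradMuNorm μ v z)) ^ (((d : ℝ) + k) / (d + k - 1)) := by
  classical
  have hd' : (1 : ℝ) ≤ d := by exact_mod_cast hd
  have hk' : (1 : ℝ) ≤ k := by exact_mod_cast hk
  have hN : (0 : ℝ) < d + k - 1 := by linarith
  have hcard : (Fintype.card (Fin d ⊕ Fin k) : ℝ) = d + k := by simp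
  have hconj : Real.HolderConjugate (Fintype.card (Fin d ⊕ Fin k))
      (((d : ℝ) + k) / (d + k - 1)) := by
    rw [hcard]; exact Real.HolderConjugate.conjExponent (by linarith)
  have hGm : Measurable fun z => ENNReal.ofReal (gradMuNorm μ v z) :=
    (continuous_gradMuNorm hμ hv).measurable.ennreal_ofReal
  have hLm : Measurable fun z : GSpace d k => ENNReal.ofReal (‖z.1‖ ^ (μ * k / (d + k - 1)) *
        |v z| ^ (((d : ℝ) + k) / (d + k - 1))) := by
    have := hv.continuous.measurable
    fun_prop
  have h := lintegral_prod_lintegral_pow_le (fun _ : Fin d ⊕ Fin k => (volume : Measure ℝ)) hconj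
    (hGm.comp (coordEquiv d k).continuous.measurable)
  rw [← (measurePreserving_coordEquiv (d := d) (k := k)).lintegral_comp hLm,
    ← (measurePreserving_coordEquiv (d := d) (k := k)).lintegral_comp hGm]
  refine le_trans ?_ h
  rw [volume_pi]
  refine lintegral_mono fun f => ?_
  dsimp only [Function.comp_apply]
  calc ENNReal.ofReal (‖(coordEquiv d k f).1‖ ^ (μ * k / (d + k - 1)) *
        |v (coordEquiv d k f)| ^ (((d : ℝ) + k) / (d + k - 1)))
      = ∏ i, (gridWeight μ f i * ENNReal.ofReal |v (coordEquiv d k f)|) ^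
          ((1 : ℝ) / (Fintype.card (Fin d ⊕ Fin k) - 1 : ℝ)) := by
        rw [hcard, Fintype.prod_sum_type]
        simp only [gridWeight, Sum.elim_inl, Sum.elim_inr, Pi.one_apply, one_mul,
          Finset.prod_const, Finset.card_univ, Fintype.card_fin]
        rw [← ENNReal.ofReal_mul (by positivity), ENNReal.ofReal_rpow_of_nonneg (by positivity)
          (by positivity), ENNReal.ofReal_rpow_of_nonneg (by positivity) (by positivity),
          ← ENNReal.ofReal_pow (by positivity), ← ENNReal.ofReal_pow (by positivity),
          ← ENNReal.ofReal_mul (by positivity)]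
        congr 1
        rw [← rpow_natCast, ← rpow_natCast, ← rpow_mul (by positivity), ← rpow_mul (by positivity),
          mul_rpow (by positivity) (by positivity), ← rpow_mul (by positivity), mul_left_comm,
          ← rpow_add_of_nonneg (by positivity) (by positivity) (by positivity)]
        congr 2 <;> field_simp
    _ ≤ _ := by
        gcongr with i
        · have : (0 : ℝ) < Fintype.card (Fin d ⊕ Fin k) - 1 := by rw [hcard]; exact hN
          positivity
        · exact gridWeight_mul_le hv hvc f i

end Grid

section Sobolev

variable {d k : ℕ} {μ : ℝ}

lemma ae_fst_ne_zero (hd : 1 ≤ d) : ∀ᵐ z : GSpace d k, z.1 ≠ 0 := by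
  have : Nontrivial (EuclideanSpace ℝ (Fin d)) := by
    have : Nonempty (Fin d) := ⟨⟨0, hd⟩⟩
    infer_instance
  have h : ∀ᵐ x : EuclideanSpace ℝ (Fin d), x ≠ 0 := by
    simp [ae_iff]
  exact Measure.quasiMeasurePreserving_fst.ae h

lemma lintegral_rpow_lt_top_of_hasCompactSupport {v : GSpace d k → ℝ} (hv : Continuous v)
    (hvc : HasCompactSupport v) {r : ℝ} (hr : 0 < r) :
    ∫⁻ z, ENNReal.ofReal |v z| ^ r < ∞ := by
  have h1 : Continuous fun z => |v z| ^ r := hv.abs.rpow_const fun _ => Or.inr hr.le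
  have h2 : HasCompactSupport fun z => |v z| ^ r :=
    hvc.comp_left (g := fun t => |t| ^ r) (by simp [hr.ne'])
  refine lt_of_eq_of_lt (lintegral_congr fun z => ?_)
    (h1.integrable_of_hasCompactSupport h2 (μ := volume)).lintegral_lt_top
  rw [ENNReal.ofReal_rpow_of_nonneg (abs_nonneg _) hr.le]

lemma abs_eulerDeriv_zero_le {v : GSpace d k → ℝ} (hv : Differentiable ℝ v) (z : GSpace d k) :
    |eulerDeriv 0 v z| ≤ ‖z.1‖ * gradMuNorm μ v z := by
  have h := abs_fderiv_le_gradMuNorm (μ := μ) (hv z) z.1 0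
  simpa [eulerDeriv, mul_comm] using h

lemma exists_lintegral_gradMuNorm_sub_comp_dil_le (hμ : 0 < μ) {ν l : ℝ} (hl : 1 ≤ l)
    (hν : ν ≤ 1 + μ) :
    ∃ C : ℝ≥0∞, C ≠ ∞ ∧ ∀ v : GSpace d k → ℝ, ContDiff ℝ 1 v →
      ∫⁻ z, ENNReal.ofReal (gradMuNorm μ (fun z => v z - v (dil ν l z)) z) ≤
        C * ∫⁻ z, ENNReal.ofReal (gradMuNorm μ v z) := by
  have hl0 : 0 < l := by linarith
  refine ⟨1 + ENNReal.ofReal l * ENNReal.ofReal (l ^ (-(d + ν * k))), by finiteness,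
    fun v hv => ?_⟩
  have hd := hv.differentiable one_ne_zero
  have hdT := (hv.comp_dil (ν := ν) hl0).differentiable one_ne_zero
  calc ∫⁻ z, ENNReal.ofReal (gradMuNorm μ (fun z => v z - v (dil ν l z)) z)
      ≤ ∫⁻ z, (ENNReal.ofReal (gradMuNorm μ v z) +
          ENNReal.ofReal l * ENNReal.ofReal (gradMuNorm μ v (dil ν l z))) := by
        refine lintegral_mono fun z => ?_
        dsimp only
        rw [← ENNReal.ofReal_mul hl0.le, ← ENNReal.ofReal_add (gradMuNorm_nonneg _ _)
          (mul_nonneg hl0.le (gradMuNorm_nonneg _ _))]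
        exact ENNReal.ofReal_le_ofReal ((gradMuNorm_sub_le (hd z) (hdT z)).trans
          (add_le_add_right (gradMuNorm_comp_dil_le hl hν (hd _)) _))
    _ = _ := by
        rw [lintegral_add_left (continuous_gradMuNorm hμ hv).measurable.ennreal_ofReal,
          lintegral_const_mul' _ _ ENNReal.ofReal_ne_top,
          lintegral_comp_dil hl0 (fun z => ENNReal.ofReal (gradMuNorm μ v z))]
        ring

/-- The Sobolev inequality for the Grushin gradient in `L¹`. -/
lemma exists_lintegral_le_lintegral_gradMuNorm (hd : 1 ≤ d) (hk : 1 ≤ k) (hμ : 0 < μ) {Q : ℝ}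
    (hQ : Q = d + (1 + μ) * k) :
    ∃ C : ℝ≥0∞, C ≠ ∞ ∧ ∀ v : GSpace d k → ℝ, ContDiff ℝ 1 v → HasCompactSupport v →
      ∫⁻ z, ENNReal.ofReal |v z| ^ (Q / (Q - 1)) ≤
        C * (∫⁻ z, ENNReal.ofReal (gradMuNorm μ v z)) ^ (Q / (Q - 1)) := by
  have hd' : (1 : ℝ) ≤ d := by exact_mod_cast hd
  have hk' : (1 : ℝ) ≤ k := by exact_mod_cast hk
  have hN : (0 : ℝ) < d + k - 1 := by linarith
  have hμk : 0 < μ * k := by positivity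
  have hQ1 : 0 < Q - 1 := by rw [hQ]; linarith
  have hQ0 : 0 < Q := by linarith
  set q := Q / (Q - 1) with hq
  have hq0 : 0 < q := by positivity
  set l : ℝ := 2 ^ (q + 1) with hl
  have hl1 : 1 ≤ l := one_le_rpow (by norm_num) (by linarith)
  have hl0 : 0 < l := by linarith
  obtain ⟨C₁, hC₁, H₁⟩ := exists_lintegral_sub_comp_dil_le (d := d) (k := k) (ν := 0) (t := -1)
    hl1 le_rfl (W := fun z => ‖z.1‖⁻¹) (fun z => by positivity) (by fun_prop)
    (fun τ hτ z => by simp [dil, norm_smul, abs_of_pos hτ, rpow_neg_one, mul_comm])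
  obtain ⟨C₂, hC₂, H₂⟩ := exists_lintegral_gradMuNorm_sub_comp_dil_le (d := d) (k := k) hμ
    (ν := 0) hl1 (by linarith)
  set θ := μ * k / (Q - 1) with hθ
  set n := ((d : ℝ) + k) / (d + k - 1) with hn
  have hθ0 : 0 ≤ θ := by positivity
  have hθ1 : 1 - θ = (d + k - 1) / (Q - 1) := by
    rw [hθ, eq_div_iff hQ1.ne', sub_mul, div_mul_cancel₀ _ hQ1.ne', hQ]
    ring
  have hθ2 : 0 ≤ 1 - θ := by rw [hθ1]; positivity
  have hn0 : 0 ≤ n := by positivity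
  have hθn : θ + n * (1 - θ) = q := by
    rw [hθ1, hθ, hn, hq, div_mul_div_cancel₀ hN.ne', ← add_div, hQ]; congr 1; ring
  refine ⟨2 ^ (q + 1) * (C₁ ^ θ * C₂ ^ (n * (1 - θ))), by finiteness, fun v hv hvc => ?_⟩
  have hdv := hv.differentiable one_ne_zero
  have hvT := hv.comp_dil (ν := 0) hl0
  set w : GSpace d k → ℝ := fun z => v z - v (dil 0 l z) with hw
  have hwc : ContDiff ℝ 1 w := hv.sub hvT
  have hws : HasCompactSupport w := hvc.sub (hvc.comp_dil hl0)
  set I := ∫⁻ z, ENNReal.ofReal (gradMuNorm μ v z)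
  have hA : ∫⁻ z, ENNReal.ofReal (‖z.1‖⁻¹ * |w z|) ≤ C₁ * I := by
    have := H₁ v hv
    simp only [ENNReal.rpow_one] at this
    refine this.trans (mul_le_mul_right (lintegral_mono fun z => ENNReal.ofReal_le_ofReal ?_) _)
    calc ‖z.1‖⁻¹ * |eulerDeriv 0 v z| ≤ ‖z.1‖⁻¹ * (‖z.1‖ * gradMuNorm μ v z) := by
          gcongr; exact abs_eulerDeriv_zero_le hdv z
      _ = (‖z.1‖⁻¹ * ‖z.1‖) * gradMuNorm μ v z := by ring
      _ ≤ 1 * gradMuNorm μ v z := by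
          gcongr
          · exact gradMuNorm_nonneg _ _
          · exact inv_mul_le_one
      _ = _ := one_mul _
  have hB : ∫⁻ z, ENNReal.ofReal (‖z.1‖ ^ (μ * k / (d + k - 1)) * |w z| ^ n) ≤ (C₂ * I) ^ n :=
    (lintegral_grid_le hd hk hμ hwc hws).trans (by gcongr; exact H₂ v hv)
  have hwm := hwc.continuous.measurable
  have hH : ∫⁻ z, ENNReal.ofReal |w z| ^ q ≤ (C₁ * I) ^ θ * ((C₂ * I) ^ n) ^ (1 - θ) := by
    calc ∫⁻ z, ENNReal.ofReal |w z| ^ q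
        ≤ ∫⁻ z, ENNReal.ofReal (‖z.1‖⁻¹ * |w z|) ^ θ *
          ENNReal.ofReal (‖z.1‖ ^ (μ * k / (d + k - 1)) * |w z| ^ n) ^ (1 - θ) := by
          refine lintegral_mono_ae ?_
          filter_upwards [ae_fst_ne_zero (k := k) hd] with z hz
          have hz' : 0 < ‖z.1‖ := norm_pos_iff.2 hz
          apply le_of_eq
          rw [ENNReal.ofReal_rpow_of_nonneg (by positivity) hq0.le,
            ENNReal.ofReal_rpow_of_nonneg (by positivity) hθ0,
            ENNReal.ofReal_rpow_of_nonneg (by positivity) hθ2, ← ENNReal.ofReal_mul (by positivity)]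
          congr 1
          rw [mul_rpow (by positivity) (by positivity), mul_rpow (by positivity) (by positivity),
            ← rpow_mul (by positivity), ← rpow_mul (by positivity), ← rpow_neg_one,
            ← rpow_mul (by positivity), mul_mul_mul_comm, ← rpow_add hz',
            ← rpow_add_of_nonneg (by positivity) (by positivity) (by positivity), hθn,
            show -1 * θ + μ * k / (d + k - 1) * (1 - θ) = 0 by rw [hθ1, hθ]; field_simp; ring]
          simp
      _ ≤ _ := by
          refine (ENNReal.lintegral_mul_norm_pow_le (by fun_prop) (by fun_prop) hθ0 hθ2
            (by ring)).trans ?_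
          gcongr
  have hC := lintegral_le_lintegral_sub_comp_dil (d := d) (k := k) (ν := 0) (t := 0) (r := q)
    (W := fun _ => 1) hl0 hq0 (by
      simp only [zero_mul, add_zero]
      calc (2 : ℝ) ^ (q + 1) = l ^ (1 : ℝ) := by rw [rpow_one]
        _ ≤ _ := rpow_le_rpow_of_exponent_le hl1 hd') (fun _ => by simp) measurable_const
    (fun z => by simp) hv.continuous (by
      simpa using (lintegral_rpow_lt_top_of_hasCompactSupport hv.continuous hvc hq0).ne)
  simp only [one_mul] at hC
  refine hC.trans ?_
  rw [mul_assoc]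
  gcongr
  refine hH.trans_eq ?_
  rw [ENNReal.mul_rpow_of_nonneg _ _ hθ0, ← ENNReal.rpow_mul,
    ENNReal.mul_rpow_of_nonneg _ _ (by positivity), mul_mul_mul_comm,
    ← ENNReal.rpow_add_of_nonneg _ _ hθ0 (by positivity), hθn]

lemma ENNReal.rpow_le_of_rpow_add_le_mul {S X : ℝ≥0∞} {a b : ℝ} (hb : 0 < b)
    (hS : S ≠ ∞) (h : S ^ (a + b) ≤ S ^ a * X) : S ^ b ≤ X := by
  rcases eq_or_ne S 0 with rfl | h0
  · simp [hb]
  rw [ENNReal.rpow_add _ _ h0 hS] at h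
  exact (ENNReal.mul_le_mul_iff_right (by simp [h0, hS])
    (ENNReal.rpow_ne_top_of_ne_zero h0 hS)).1 h

/-- The Sobolev inequality for the Grushin gradient in `Lᵖ`. -/
lemma exists_rpow_lintegral_le_gradMuNorm (hd : 1 ≤ d) (hk : 1 ≤ k) (hμ : 0 < μ) {Q p : ℝ}
    (hQ : Q = d + (1 + μ) * k) (hp : 1 < p) (hpQ : p < Q) :
    ∃ C : ℝ≥0∞, C ≠ ∞ ∧ ∀ v : GSpace d k → ℝ, ContDiff ℝ 1 v → HasCompactSupport v →
      (∫⁻ z, ENNReal.ofReal |v z| ^ (p * Q / (Q - p))) ^ (1 / p - 1 / Q) ≤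
        C * (∫⁻ z, ENNReal.ofReal (gradMuNorm μ v z) ^ p) ^ (1 / p) := by
  obtain ⟨C, hC, H⟩ := exists_lintegral_le_lintegral_gradMuNorm hd hk hμ hQ
  have hp0 : 0 < p := by linarith
  have hQ0 : 0 < Q := by linarith
  have hQ1 : 0 < Q - 1 := by linarith
  have hQp : 0 < Q - p := by linarith
  have hp1 : 0 < p - 1 := by linarith
  set m := p * (Q - 1) / (Q - p) with hm
  have hm1 : 1 < m := by rw [hm, lt_div_iff₀ hQp]; nlinarith
  have hm0 : 0 < m := by linarith
  set P := p * Q / (Q - p) with hP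
  have hP0 : 0 < P := by positivity
  set q := Q / (Q - 1) with hq
  have hq0 : 0 < q := by positivity
  have hmq : m * q = P := by rw [hm, hq, hP]; field_simp
  have hb : 0 < 1 / p - 1 / Q := sub_pos.2 (one_div_lt_one_div_of_lt hp0 hpQ)
  have hconj := Real.HolderConjugate.conjExponent hp
  have hmP : (m - 1) * p.conjExponent = P := by
    rw [hm, Real.conjExponent, hP]; field_simp; ring
  refine ⟨C ^ (1 - 1 / Q) * ENNReal.ofReal m, ?_, fun v hv hvc => ?_⟩
  · have : 0 ≤ 1 - 1 / Q := by rw [sub_nonneg, div_le_one hQ0]; linarith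
    finiteness
  set S := ∫⁻ z, ENNReal.ofReal |v z| ^ P with hS
  set A := (∫⁻ z, ENNReal.ofReal (gradMuNorm μ v z) ^ p) ^ (1 / p) with hA
  have hSfin : S ≠ ∞ := (lintegral_rpow_lt_top_of_hasCompactSupport hv.continuous hvc hP0).ne
  have hphi : ContDiff ℝ 1 fun t : ℝ => |t| ^ m := contDiff_norm_rpow hm1
  have h := H (fun z => |v z| ^ m) (hphi.comp hv)
    (hvc.comp_left (g := fun t => |t| ^ m) (by simp [hm0.ne']))
  have e1 : ∫⁻ z, ENNReal.ofReal |(|v z| ^ m)| ^ q = S := by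
    refine lintegral_congr fun z => ?_
    rw [abs_of_nonneg (by positivity), ← ENNReal.ofReal_rpow_of_nonneg (by positivity) hm0.le,
      ← ENNReal.rpow_mul, hmq]
  have hvm := hv.continuous.measurable
  have hGm := (continuous_gradMuNorm hμ hv).measurable
  have e2 : ∫⁻ z, ENNReal.ofReal (gradMuNorm μ (fun z => |v z| ^ m) z) ≤
      ENNReal.ofReal m * (S ^ (1 - 1 / p) * A) := by
    calc _ ≤ ∫⁻ z, ENNReal.ofReal m *
          (ENNReal.ofReal |v z| ^ (m - 1) * ENNReal.ofReal (gradMuNorm μ v z)) := by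
          refine lintegral_mono fun z => ?_
          dsimp only
          rw [ENNReal.ofReal_rpow_of_nonneg (by positivity) (by linarith),
            ← ENNReal.ofReal_mul (by positivity), ← ENNReal.ofReal_mul (by positivity)]
          refine ENNReal.ofReal_le_ofReal ((gradMuNorm_comp_le
            (hv.differentiable one_ne_zero z) (hasDerivAt_abs_rpow (v z) hm1)).trans_eq ?_)
          rw [abs_mul, abs_mul, abs_of_pos hm0, abs_of_nonneg (by positivity), ← mul_assoc]
          congr 1
          rw [mul_assoc]
          congr 1
          rcases eq_or_ne (v z) 0 with h0 | h0
          · rw [h0]; simp [(sub_pos.2 hm1).ne']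
          · rw [← rpow_add_one (abs_pos.2 h0).ne']; congr 1; ring
      _ ≤ _ := by
          rw [lintegral_const_mul' _ _ ENNReal.ofReal_ne_top]
          gcongr
          refine (ENNReal.lintegral_mul_le_Lp_mul_Lq volume hconj.symm (by fun_prop)
            (by fun_prop)).trans_eq ?_
          simp_rw [← ENNReal.rpow_mul, hmP]
          rw [hS, hA]
          congr 2
          rw [Real.conjExponent]; field_simp
  rw [e1] at h
  have h2 : S ^ ((1 - 1 / p) + (1 / p - 1 / Q)) ≤
      S ^ (1 - 1 / p) * (C ^ (1 - 1 / Q) * ENNReal.ofReal m * A) := by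
    have h3 : S ≤ C * (ENNReal.ofReal m * (S ^ (1 - 1 / p) * A)) ^ q := h.trans (by gcongr)
    have hqi : q * (1 - 1 / Q) = 1 := by rw [hq]; field_simp
    have h1Q : 0 ≤ 1 - 1 / Q := by rw [sub_nonneg, div_le_one hQ0]; linarith
    calc S ^ ((1 - 1 / p) + (1 / p - 1 / Q)) = S ^ (1 - 1 / Q) := by congr 1; ring
      _ ≤ (C * (ENNReal.ofReal m * (S ^ (1 - 1 / p) * A)) ^ q) ^ (1 - 1 / Q) := by gcongr
      _ = _ := by
        rw [ENNReal.mul_rpow_of_nonneg _ _ h1Q, ← ENNReal.rpow_mul, hqi, ENNReal.rpow_one]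
        ring
  exact ENNReal.rpow_le_of_rpow_add_le_mul hb hSfin h2

end Sobolev

section Weight

variable {d k : ℕ} {μ : ℝ}

/-- The power `ρ^{2+2μ}` of the distance function. -/
noncomputable def grhoPow (μ : ℝ) (z : GSpace d k) : ℝ :=
  ‖z.1‖ ^ (2 + 2 * μ) + (1 + μ) ^ 2 * ‖z.2‖ ^ 2

lemma grhoPow_nonneg (z : GSpace d k) : 0 ≤ grhoPow μ z := by
  unfold grhoPow; positivity

lemma grho_eq_grhoPow (z : GSpace d k) : grho μ z = grhoPow μ z ^ (1 / (2 + 2 * μ)) := rfl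

lemma grho_nonneg (z : GSpace d k) : 0 ≤ grho μ z :=
  rpow_nonneg (grhoPow_nonneg z) _

lemma grhoPow_pos {z : GSpace d k} (hz : z.1 ≠ 0) : 0 < grhoPow μ z := by
  have : 0 < ‖z.1‖ := norm_pos_iff.2 hz
  unfold grhoPow; positivity

lemma grho_pos {z : GSpace d k} (hz : z.1 ≠ 0) : 0 < grho μ z :=
  rpow_pos_of_pos (grhoPow_pos hz) _

lemma grho_rpow (z : GSpace d k) (s : ℝ) :
    grho μ z ^ s = grhoPow μ z ^ (s / (2 + 2 * μ)) := by
  rw [grho_eq_grhoPow, ← rpow_mul (grhoPow_nonneg z)]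
  congr 1
  ring

lemma continuous_grhoPow (hμ : 0 < μ) : Continuous (grhoPow μ : GSpace d k → ℝ) := by
  unfold grhoPow
  exact (continuous_fst.norm.rpow_const fun _ => Or.inr (by linarith)).add (by fun_prop)

lemma continuous_grho (hμ : 0 < μ) : Continuous (grho μ : GSpace d k → ℝ) :=
  (continuous_grhoPow hμ).rpow_const fun _ => Or.inr (by positivity)

lemma norm_fst_le_grho (hμ : 0 < μ) (z : GSpace d k) : ‖z.1‖ ≤ grho μ z := by
  have h : (‖z.1‖ ^ (2 + 2 * μ)) ^ (1 / (2 + 2 * μ)) ≤ grho μ z := by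
    refine rpow_le_rpow (by positivity) ?_ (by positivity)
    have : 0 ≤ (1 + μ) ^ 2 * ‖z.2‖ ^ 2 := by positivity
    linarith
  rwa [← rpow_mul (norm_nonneg _), mul_one_div_cancel (by positivity), rpow_one] at h

lemma norm_snd_le_grho (hμ : 0 < μ) (z : GSpace d k) : ‖z.2‖ ≤ grho μ z ^ (1 + μ) := by
  rw [grho_rpow, show (1 + μ) / (2 + 2 * μ) = 1 / 2 by field_simp, ← sqrt_eq_rpow]
  refine le_sqrt_of_sq_le ?_
  have h1 : 0 ≤ ‖z.1‖ ^ (2 + 2 * μ) := by positivity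
  have h2 : 0 ≤ ‖z.2‖ ^ 2 := by positivity
  unfold grhoPow
  nlinarith [mul_nonneg hμ.le h2, mul_nonneg (mul_nonneg hμ.le hμ.le) h2]

lemma grho_dil (hμ : 0 < μ) {τ : ℝ} (hτ : 0 < τ) (z : GSpace d k) :
    grho μ (dil (1 + μ) τ z) = τ * grho μ z := by
  have h : grhoPow μ (dil (1 + μ) τ z) = τ ^ (2 + 2 * μ) * grhoPow μ z := by
    simp only [grhoPow, dil, norm_smul, Real.norm_eq_abs, abs_of_pos hτ,
      abs_of_pos (rpow_pos_of_pos hτ (1 + μ))]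
    rw [mul_rpow hτ.le (norm_nonneg _), mul_pow, ← rpow_natCast (τ ^ (1 + μ)), ← rpow_mul hτ.le]
    rw [show (1 + μ) * ((2 : ℕ) : ℝ) = 2 + 2 * μ by push_cast; ring]
    ring
  rw [grho_eq_grhoPow, h, mul_rpow (by positivity) (grhoPow_nonneg z), ← rpow_mul hτ.le,
    mul_one_div_cancel (by positivity), rpow_one, grho_eq_grhoPow]

/-- The angular function `|x|^μ / ρ^μ`. -/
noncomputable def ang (μ : ℝ) (z : GSpace d k) : ℝ := ‖z.1‖ ^ μ / grho μ z ^ μ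

lemma ang_nonneg (z : GSpace d k) : 0 ≤ ang μ z :=
  div_nonneg (by positivity) (rpow_nonneg (grho_nonneg z) _)

lemma ang_pos {z : GSpace d k} (hz : z.1 ≠ 0) : 0 < ang μ z :=
  div_pos (rpow_pos_of_pos (norm_pos_iff.2 hz) _) (rpow_pos_of_pos (grho_pos hz) _)

lemma ang_dil (hμ : 0 < μ) {τ : ℝ} (hτ : 0 < τ) (z : GSpace d k) :
    ang μ (dil (1 + μ) τ z) = ang μ z := by
  have : τ ^ μ ≠ 0 := (rpow_pos_of_pos hτ μ).ne'
  rw [ang, grho_dil hμ hτ]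
  simp only [dil, norm_smul, Real.norm_eq_abs, abs_of_pos hτ]
  rw [mul_rpow hτ.le (norm_nonneg _), mul_rpow hτ.le (grho_nonneg z), mul_div_mul_left _ _ this,
    ang]

/-- The weights `(|x|^μ / ρ^μ)^s ρ^t`. -/
noncomputable def wt (μ s t : ℝ) (z : GSpace d k) : ℝ := ang μ z ^ s * grho μ z ^ t

lemma wt_nonneg (s t : ℝ) (z : GSpace d k) : 0 ≤ wt μ s t z :=
  mul_nonneg (rpow_nonneg (ang_nonneg z) _) (rpow_nonneg (grho_nonneg z) _)

lemma wt_zero_left (t : ℝ) (z : GSpace d k) : wt μ 0 t z = grho μ z ^ t := by simp [wt]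

lemma measurable_ang (hμ : 0 < μ) : Measurable (ang μ : GSpace d k → ℝ) := by
  have := (continuous_grho (d := d) (k := k) hμ).measurable
  unfold ang; fun_prop

lemma measurable_wt (hμ : 0 < μ) (s t : ℝ) : Measurable (wt μ s t : GSpace d k → ℝ) := by
  have h1 := measurable_ang (d := d) (k := k) hμ
  have h2 := (continuous_grho (d := d) (k := k) hμ).measurable
  unfold wt; fun_prop

lemma wt_dil (hμ : 0 < μ) {s t τ : ℝ} (hτ : 0 < τ) (z : GSpace d k) :
    wt μ s t (dil (1 + μ) τ z) = τ ^ t * wt μ s t z := by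
  rw [wt, ang_dil hμ hτ, grho_dil hμ hτ, mul_rpow hτ.le (grho_nonneg z), wt]
  ring

lemma wt_mul_wt {s t s' t' : ℝ} {z : GSpace d k} (hz : z.1 ≠ 0) :
    wt μ s t z * wt μ s' t' z = wt μ (s + s') (t + t') z := by
  simp only [wt]
  rw [rpow_add (ang_pos hz), rpow_add (grho_pos hz)]
  ring

lemma wt_rpow (s t r : ℝ) (z : GSpace d k) : wt μ s t z ^ r = wt μ (s * r) (t * r) z := by
  simp only [wt]
  rw [mul_rpow (rpow_nonneg (ang_nonneg z) _) (rpow_nonneg (grho_nonneg z) _),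
    ← rpow_mul (ang_nonneg z), ← rpow_mul (grho_nonneg z)]

lemma abs_eulerDeriv_le_gradMuNorm (hμ : 0 < μ) {v : GSpace d k → ℝ} (hv : Differentiable ℝ v)
    {z : GSpace d k} (hz : z.1 ≠ 0) :
    |eulerDeriv (1 + μ) v z| ≤ wt μ (-1) 1 z * gradMuNorm μ v z := by
  have hx : 0 < ‖z.1‖ := norm_pos_iff.2 hz
  have hxμ : 0 < ‖z.1‖ ^ μ := rpow_pos_of_pos hx μ
  have h := abs_fderiv_le_gradMuNorm (μ := μ) (hv z) z.1 (((1 + μ) / ‖z.1‖ ^ μ) • z.2)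
  rw [smul_smul, mul_div_cancel₀ _ hxμ.ne'] at h
  rw [eulerDeriv, mul_comm]
  refine h.trans_eq ?_
  congr 1
  have hg := grho_pos (μ := μ) hz
  have e : wt μ (-1) 1 z = grho μ z ^ (1 + μ) / ‖z.1‖ ^ μ := by
    rw [wt, rpow_neg_one, ang, inv_div, rpow_one, rpow_add hg, rpow_one]
    ring
  rw [e, grho_rpow, show (1 + μ) / (2 + 2 * μ) = 1 / 2 by field_simp, ← sqrt_eq_rpow,
    norm_smul, Real.norm_eq_abs, abs_of_pos (by positivity), eq_div_iff hxμ.ne']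
  nth_rw 2 [← sqrt_sq hxμ.le]
  rw [← sqrt_mul (by positivity)]
  congr 1
  have : ‖z.1‖ ^ (2 + 2 * μ) = ‖z.1‖ ^ 2 * (‖z.1‖ ^ μ) ^ 2 := by
    rw [rpow_add hx, mul_comm 2 μ, rpow_mul hx.le]
    norm_num
  rw [grhoPow, this]
  field_simp

lemma contDiff_grhoPow (hμ : 0 < μ) : ContDiff ℝ 1 (grhoPow μ : GSpace d k → ℝ) := by
  unfold grhoPow
  exact (contDiff_fst.norm_rpow (by linarith)).add (contDiff_const.mul (contDiff_snd.norm_sq ℝ))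

lemma gradMuNorm_grhoPow_le (hμ : 0 < μ) (z : GSpace d k) :
    gradMuNorm μ (grhoPow μ) z ≤ (2 + 2 * μ) * (‖z.1‖ ^ μ * √(grhoPow μ z)) := by
  refine gradMuNorm_le ((contDiff_grhoPow hμ).differentiable one_ne_zero z) (by positivity)
    fun a b => ?_
  have hd1 : HasFDerivAt (fun z : GSpace d k => ‖z.1‖ ^ (2 + 2 * μ))
      ((((2 + 2 * μ) * ‖z.1‖ ^ (2 + 2 * μ - 2)) • innerSL ℝ z.1).comp
        (ContinuousLinearMap.fst ℝ _ _)) z :=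
    (hasFDerivAt_norm_rpow z.1 (by linarith)).comp z hasFDerivAt_fst
  have hd2 : HasFDerivAt (fun z : GSpace d k => (1 + μ) ^ 2 * ‖z.2‖ ^ 2)
      ((1 + μ) ^ 2 • (2 • (innerSL ℝ z.2).comp (ContinuousLinearMap.snd ℝ _ _))) z :=
    (HasFDerivAt.norm_sq hasFDerivAt_snd).const_mul _
  have hD : fderiv ℝ (grhoPow μ) z (a, ‖z.1‖ ^ μ • b) =
      (2 + 2 * μ) * (‖z.1‖ ^ μ * (‖z.1‖ ^ μ * ⟪z.1, a⟫ + (1 + μ) * ⟪z.2, b⟫)) := by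
    have := (hd1.add hd2).fderiv
    rw [show grhoPow μ = (fun z : GSpace d k => ‖z.1‖ ^ (2 + 2 * μ)) +
      fun z : GSpace d k => (1 + μ) ^ 2 * ‖z.2‖ ^ 2 from rfl, this]
    have e : ‖z.1‖ ^ (2 + 2 * μ - 2) = ‖z.1‖ ^ μ * ‖z.1‖ ^ μ := by
      rw [← rpow_add_of_nonneg (norm_nonneg _) hμ.le hμ.le]; congr 1; ring
    simp only [add_apply, ContinuousLinearMap.comp_apply,
      smul_apply, innerSL_apply_apply, ContinuousLinearMap.coe_fst',
      ContinuousLinearMap.coe_snd', smul_eq_mul, inner_smul_right, e]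
    ring
  rw [hD, abs_mul, abs_mul, abs_of_pos (by linarith), abs_of_nonneg (by positivity), mul_assoc,
    mul_assoc]
  gcongr
  rw [← sqrt_mul (grhoPow_nonneg z)]
  refine le_sqrt_of_sq_le ?_
  have h1 : |‖z.1‖ ^ μ * ⟪z.1, a⟫ + (1 + μ) * ⟪z.2, b⟫| ≤
      ‖z.1‖ ^ μ * ‖z.1‖ * ‖a‖ + (1 + μ) * ‖z.2‖ * ‖b‖ := by
    refine (abs_add_le _ _).trans ?_
    rw [abs_mul, abs_mul, abs_of_nonneg (by positivity : 0 ≤ ‖z.1‖ ^ μ),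
      abs_of_pos (by linarith : 0 < 1 + μ), mul_assoc, mul_assoc]
    gcongr <;> exact abs_real_inner_le_norm _ _
  have h2 : grhoPow μ z = (‖z.1‖ ^ μ * ‖z.1‖) ^ 2 + ((1 + μ) * ‖z.2‖) ^ 2 := by
    rw [← rpow_add_one' (norm_nonneg _) (by linarith), ← rpow_natCast (‖z.1‖ ^ (μ + 1)),
      ← rpow_mul (norm_nonneg _), grhoPow, mul_pow]
    congr 3
    push_cast; ring
  rw [h2]
  calc _ ≤ (‖z.1‖ ^ μ * ‖z.1‖ * ‖a‖ + (1 + μ) * ‖z.2‖ * ‖b‖) ^ 2 := by gcongr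
    _ ≤ _ := by
      nlinarith [sq_nonneg (‖z.1‖ ^ μ * ‖z.1‖ * ‖b‖ - (1 + μ) * ‖z.2‖ * ‖a‖)]

end Weight

section WeightedSobolev

variable {d k : ℕ} {μ : ℝ}

/-- A regularization of the power `t ^ a` near `t = 0`. -/
noncomputable def regPow (a M ε t : ℝ) : ℝ := t ^ (a + M) * (t + ε) ^ (-M)

lemma regPow_nonneg {a M ε t : ℝ} (hε : 0 < ε) (ht : 0 ≤ t) : 0 ≤ regPow a M ε t := by
  unfold regPow; positivity

lemma regPow_le {a M ε t : ℝ} (hM : 0 ≤ M) (hε : 0 < ε) (ht : 0 < t) :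
    regPow a M ε t ≤ t ^ a := by
  calc regPow a M ε t ≤ t ^ (a + M) * t ^ (-M) := by
        unfold regPow
        exact mul_le_mul_of_nonneg_left
          (rpow_le_rpow_of_nonpos ht (by linarith) (by linarith)) (by positivity)
    _ = t ^ a := by rw [← rpow_add ht]; congr 1; ring

lemma hasDerivAt_regPow {a M ε t : ℝ} (hM : 1 ≤ a + M) (hε : 0 < ε) (ht : 0 ≤ t) :
    HasDerivAt (regPow a M ε) ((a + M) * t ^ (a + M - 1) * (t + ε) ^ (-M) +
      t ^ (a + M) * (-M * (t + ε) ^ (-M - 1))) t := by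
  have h1 : HasDerivAt (fun t : ℝ => t ^ (a + M)) ((a + M) * t ^ (a + M - 1)) t :=
    hasDerivAt_rpow_const (Or.inr hM)
  have h2 : HasDerivAt (fun t : ℝ => (t + ε) ^ (-M)) (-M * (t + ε) ^ (-M - 1)) t := by
    have := (hasDerivAt_id t).add_const ε
    simpa using this.rpow_const (p := -M) (Or.inl (by simp; linarith))
  exact h1.mul h2

lemma abs_deriv_regPow_le {a M ε t : ℝ} (hM : 0 ≤ M) (hε : 0 < ε) (ht : 0 < t) :
    |(a + M) * t ^ (a + M - 1) * (t + ε) ^ (-M) + t ^ (a + M) * (-M * (t + ε) ^ (-M - 1))| ≤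
      (|a| + 2 * M) * t ^ (a - 1) := by
  have h1 : (t + ε) ^ (-M) ≤ t ^ (-M) := rpow_le_rpow_of_nonpos ht (by linarith) (by linarith)
  have h2 : (t + ε) ^ (-M - 1) ≤ t ^ (-M - 1) :=
    rpow_le_rpow_of_nonpos ht (by linarith) (by linarith)
  refine (abs_add_le _ _).trans ?_
  rw [abs_mul, abs_mul, abs_mul, abs_mul, abs_neg, abs_of_nonneg hM,
    abs_of_nonneg (by positivity : 0 ≤ t ^ (a + M - 1)),
    abs_of_nonneg (by positivity : 0 ≤ t ^ (a + M)),
    abs_of_nonneg (by positivity : 0 ≤ (t + ε) ^ (-M)),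
    abs_of_nonneg (by positivity : 0 ≤ (t + ε) ^ (-M - 1))]
  calc |a + M| * t ^ (a + M - 1) * (t + ε) ^ (-M) + t ^ (a + M) * (M * (t + ε) ^ (-M - 1))
      ≤ (|a| + M) * t ^ (a + M - 1) * t ^ (-M) + t ^ (a + M) * (M * t ^ (-M - 1)) := by
        gcongr
        exact (abs_add_le _ _).trans_eq (by rw [abs_of_nonneg hM])
    _ = (|a| + M) * (t ^ (a + M - 1) * t ^ (-M)) + M * (t ^ (a + M) * t ^ (-M - 1)) := by ring
    _ = _ := by
        rw [← rpow_add ht, ← rpow_add ht, show a + M - 1 + -M = a - 1 by ring,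
          show a + M + (-M - 1) = a - 1 by ring]
        ring

lemma tendsto_regPow {a M t : ℝ} (ht : 0 < t) :
    Filter.Tendsto (fun n : ℕ => regPow a M (1 / ((n : ℝ) + 1)) t) Filter.atTop
      (nhds (t ^ a)) := by
  have h1 : Filter.Tendsto (fun n : ℕ => t + 1 / ((n : ℝ) + 1)) Filter.atTop (nhds (t + 0)) :=
    tendsto_one_div_add_atTop_nhds_zero_nat.const_add t
  rw [add_zero] at h1
  have h2 := (h1.rpow_const (p := -M) (Or.inl ht.ne')).const_mul (t ^ (a + M))
  have e : t ^ (a + M) * t ^ (-M) = t ^ a := by rw [← rpow_add ht]; congr 1; ring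
  rwa [e] at h2

lemma contDiff_regPow_grhoPow (hμ : 0 < μ) {a M ε : ℝ} (hM : 1 ≤ a + M) (hε : 0 < ε) :
    ContDiff ℝ 1 fun z : GSpace d k => regPow a M ε (grhoPow μ z) := by
  have hT := contDiff_grhoPow (d := d) (k := k) hμ
  unfold regPow
  refine ContDiff.mul (hT.rpow_const_of_le (by exact_mod_cast hM))
    (ContDiff.rpow_const_of_ne (hT.add contDiff_const) fun z => ?_)
  have := grhoPow_nonneg (μ := μ) z
  positivity

lemma gradMuNorm_regPow_mul_le (hμ : 0 < μ) {α M ε : ℝ} (hM0 : 0 ≤ M)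
    (hM : 1 ≤ α / (2 + 2 * μ) + M) (hε : 0 < ε) {w : GSpace d k → ℝ} {z : GSpace d k}
    (hw : DifferentiableAt ℝ w z) (hz : z.1 ≠ 0) :
    gradMuNorm μ (fun z => regPow (α / (2 + 2 * μ)) M ε (grhoPow μ z) * w z) z ≤
      wt μ 0 α z * gradMuNorm μ w z +
      (|α / (2 + 2 * μ)| + 2 * M) * (2 + 2 * μ) * (wt μ 1 (α - 1) z * |w z|) := by
  set a := α / (2 + 2 * μ) with ha
  have hT : 0 < grhoPow μ z := grhoPow_pos hz
  have hdT := (contDiff_grhoPow (d := d) (k := k) hμ).differentiable one_ne_zero z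
  have hdR := (contDiff_regPow_grhoPow (d := d) (k := k) hμ hM hε).differentiable one_ne_zero z
  refine (gradMuNorm_mul_le hdR hw).trans ?_
  rw [abs_of_nonneg (regPow_nonneg hε hT.le)]
  refine add_le_add ?_ ?_
  · refine mul_le_mul_of_nonneg_right ?_ (gradMuNorm_nonneg _ _)
    rw [wt_zero_left, grho_rpow]
    exact regPow_le hM0 hε hT
  · have h1 : gradMuNorm μ (fun z => regPow a M ε (grhoPow μ z)) z ≤
        (|a| + 2 * M) * (2 + 2 * μ) * wt μ 1 (α - 1) z := by
      refine (gradMuNorm_comp_le hdT (hasDerivAt_regPow hM hε hT.le)).trans ?_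
      calc _ ≤ ((|a| + 2 * M) * grhoPow μ z ^ (a - 1)) *
            ((2 + 2 * μ) * (‖z.1‖ ^ μ * √(grhoPow μ z))) :=
            mul_le_mul (abs_deriv_regPow_le hM0 hε hT) (gradMuNorm_grhoPow_le hμ z)
              (gradMuNorm_nonneg _ _) (by positivity)
        _ = (|a| + 2 * M) * (2 + 2 * μ) *
            (‖z.1‖ ^ μ * (grhoPow μ z ^ (a - 1) * grhoPow μ z ^ (1 / 2 : ℝ))) := by
            rw [sqrt_eq_rpow]; ring
        _ = _ := by
            congr 1
            rw [← rpow_add hT, wt, rpow_one, ang, div_mul_eq_mul_div, mul_div_assoc,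
              ← rpow_sub (grho_pos hz), grho_rpow, ha]
            congr 2
            field_simp
            ring
    calc |w z| * _ ≤ |w z| * ((|a| + 2 * M) * (2 + 2 * μ) * wt μ 1 (α - 1) z) := by gcongr
      _ = _ := by ring

/-- The weighted Sobolev inequality for the Grushin gradient, with a Hardy term. -/
lemma exists_weighted_sobolev (hd : 1 ≤ d) (hk : 1 ≤ k) (hμ : 0 < μ) {Q p : ℝ}
    (hQ : Q = d + (1 + μ) * k) (hp : 1 < p) (hpQ : p < Q) (α : ℝ) :
    ∃ C : ℝ≥0∞, C ≠ ∞ ∧ ∀ w : GSpace d k → ℝ, ContDiff ℝ 1 w → HasCompactSupport w →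
      (∫⁻ z, ENNReal.ofReal (wt μ 0 α z * |w z|) ^ (p * Q / (Q - p))) ^ (1 / p - 1 / Q) ≤
        C * ((∫⁻ z, ENNReal.ofReal (wt μ 0 α z * gradMuNorm μ w z) ^ p) ^ (1 / p) +
          (∫⁻ z, ENNReal.ofReal (wt μ 1 (α - 1) z * |w z|) ^ p) ^ (1 / p)) := by
  obtain ⟨C, hC, H⟩ := exists_rpow_lintegral_le_gradMuNorm hd hk hμ hQ hp hpQ
  have hp0 : 0 < p := by linarith
  have hQp : 0 < Q - p := by linarith
  have hQ0 : 0 < Q := by linarith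
  set a := α / (2 + 2 * μ) with ha
  set M := 2 + |a| with hM
  have hM0 : 0 ≤ M := by positivity
  have hM1 : 1 ≤ a + M := by rw [hM]; linarith [neg_abs_le a]
  set K := (|a| + 2 * M) * (2 + 2 * μ) with hK
  have hK0 : 0 ≤ K := by positivity
  have hb : 0 < 1 / p - 1 / Q := sub_pos.2 (one_div_lt_one_div_of_lt hp0 hpQ)
  set P := p * Q / (Q - p) with hP
  have hP0 : 0 < P := by positivity
  have hPb : (1 / p - 1 / Q) * P = 1 := by rw [hP]; field_simp
  refine ⟨C * (1 + ENNReal.ofReal K), by finiteness, fun w hw hwc => ?_⟩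
  have hdw := hw.differentiable one_ne_zero
  set X := (∫⁻ z, ENNReal.ofReal (wt μ 0 α z * gradMuNorm μ w z) ^ p) ^ (1 / p) with hX
  set Y := (∫⁻ z, ENNReal.ofReal (wt μ 1 (α - 1) z * |w z|) ^ p) ^ (1 / p) with hY
  have hGm : Measurable fun z => wt μ 0 α z * gradMuNorm μ w z :=
    (measurable_wt hμ 0 α).mul (continuous_gradMuNorm hμ hw).measurable
  have hwm : Measurable fun z => wt μ 1 (α - 1) z * |w z| :=
    (measurable_wt hμ 1 (α - 1)).mul hw.continuous.abs.measurable
  set ε : ℕ → ℝ := fun n => 1 / ((n : ℝ) + 1) with hε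
  have hε0 : ∀ n, 0 < ε n := fun n => by rw [hε]; positivity
  set v : ℕ → GSpace d k → ℝ := fun n z => regPow a M (ε n) (grhoPow μ z) * w z with hv
  have hvC : ∀ n, ContDiff ℝ 1 (v n) := fun n =>
    (contDiff_regPow_grhoPow hμ hM1 (hε0 n)).mul hw
  have hvc : ∀ n, HasCompactSupport (v n) := fun n => hwc.mul_left
  have hG : ∀ n, (∫⁻ z, ENNReal.ofReal (gradMuNorm μ (v n) z) ^ p) ^ (1 / p) ≤
      X + ENNReal.ofReal K * Y := by
    intro n
    calc (∫⁻ z, ENNReal.ofReal (gradMuNorm μ (v n) z) ^ p) ^ (1 / p)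
        ≤ (∫⁻ z, ((fun z => ENNReal.ofReal (wt μ 0 α z * gradMuNorm μ w z)) +
            fun z => ENNReal.ofReal K * ENNReal.ofReal (wt μ 1 (α - 1) z * |w z|)) z ^ p) ^
              (1 / p) := by
          refine ENNReal.rpow_le_rpow (lintegral_mono_ae ?_) (by positivity)
          filter_upwards [ae_fst_ne_zero (k := k) hd] with z hz
          have h0 := wt_nonneg (μ := μ) 1 (α - 1) z
          have h1 := mul_nonneg (wt_nonneg (μ := μ) 0 α z) (gradMuNorm_nonneg (μ := μ) w z)
          rw [Pi.add_apply, ← ENNReal.ofReal_mul hK0, ← ENNReal.ofReal_add h1 (by positivity)]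
          gcongr
          exact gradMuNorm_regPow_mul_le hμ hM0 hM1 (hε0 n) (hdw z) hz
      _ ≤ _ := by
          refine (ENNReal.lintegral_Lp_add_le hGm.ennreal_ofReal.aemeasurable
            (hwm.ennreal_ofReal.const_mul _).aemeasurable hp.le).trans_eq ?_
          congr 1
          simp_rw [ENNReal.mul_rpow_of_nonneg _ _ hp0.le]
          rw [lintegral_const_mul' _ _ (by finiteness),
            ENNReal.mul_rpow_of_nonneg _ _ (by positivity), ← ENNReal.rpow_mul,
            mul_one_div_cancel hp0.ne', ENNReal.rpow_one]
  have hn : ∀ n, ∫⁻ z, ENNReal.ofReal |v n z| ^ P ≤ (C * (X + ENNReal.ofReal K * Y)) ^ P := by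
    intro n
    have h := (H (v n) (hvC n) (hvc n)).trans (mul_le_mul_right (hG n) C)
    have h2 := ENNReal.rpow_le_rpow h hP0.le
    rwa [← ENNReal.rpow_mul, hPb, ENNReal.rpow_one] at h2
  have hlim : ∫⁻ z, ENNReal.ofReal (wt μ 0 α z * |w z|) ^ P ≤
      (C * (X + ENNReal.ofReal K * Y)) ^ P := by
    calc ∫⁻ z, ENNReal.ofReal (wt μ 0 α z * |w z|) ^ P
        = ∫⁻ z, Filter.liminf (fun n => ENNReal.ofReal |v n z| ^ P) Filter.atTop := by
          refine lintegral_congr_ae ?_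
          filter_upwards [ae_fst_ne_zero (k := k) hd] with z hz
          refine (Filter.Tendsto.liminf_eq ?_).symm
          refine (ENNReal.continuous_rpow_const.tendsto _).comp
            ((ENNReal.continuous_ofReal.tendsto _).comp ?_)
          have h1 : wt μ 0 α z * |w z| = |grhoPow μ z ^ a * w z| := by
            rw [wt_zero_left, grho_rpow, abs_mul, abs_of_nonneg (rpow_nonneg (grhoPow_nonneg z) _)]
          rw [h1]
          exact ((tendsto_regPow (grhoPow_pos hz)).mul_const (w z)).abs
      _ ≤ Filter.liminf (fun n => ∫⁻ z, ENNReal.ofReal |v n z| ^ P) Filter.atTop :=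
          lintegral_liminf_le fun n =>
            ((hvC n).continuous.abs.measurable.ennreal_ofReal).pow_const P
      _ ≤ _ := Filter.liminf_le_of_frequently_le'
          (Filter.Frequently.of_forall hn)
  calc _ ≤ ((C * (X + ENNReal.ofReal K * Y)) ^ P) ^ (1 / p - 1 / Q) := by gcongr
    _ = C * (X + ENNReal.ofReal K * Y) := by
      rw [← ENNReal.rpow_mul, mul_comm P, hPb, ENNReal.rpow_one]
    _ ≤ C * ((1 + ENNReal.ofReal K) * (X + Y)) := by
      gcongr
      calc X + ENNReal.ofReal K * Y ≤ X + ENNReal.ofReal K * Y + (ENNReal.ofReal K * X + Y) :=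
            le_self_add
        _ = _ := by ring
    _ = _ := by ring

end WeightedSobolev

section Integrability

variable {d k : ℕ} {μ : ℝ}

lemma setLIntegral_ball_rpow_lt_top (hd : 1 ≤ d) {c : ℝ} (hc : 0 < d + c) (R : ℝ) :
    ∫⁻ x in Metric.ball (0 : EuclideanSpace ℝ (Fin d)) R, ENNReal.ofReal (‖x‖ ^ c) < ∞ := by
  have hm : Measurable fun x : EuclideanSpace ℝ (Fin d) => ‖x‖ ^ c := by fun_prop
  have h := integrableOn_ball_of_norm_le_rpow (μ := volume)
    (f := fun x : EuclideanSpace ℝ (Fin d) => ‖x‖ ^ c) (r := R) (C := 1) (α := -c)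
    (by simpa using hd) (by simp; linarith)
    (Filter.Eventually.of_forall fun x => by
      rw [Real.norm_of_nonneg (by positivity), neg_neg, one_mul]) hm.aestronglyMeasurable
  exact Integrable.lintegral_lt_top h

lemma measurableSet_grho_preimage (hμ : 0 < μ) {S : Set ℝ} (hS : MeasurableSet S) :
    MeasurableSet {z : GSpace d k | grho μ z ∈ S} :=
  (continuous_grho hμ).measurable hS

lemma setLIntegral_wt_scale (hμ : 0 < μ) {Q : ℝ} (hQ : Q = d + (1 + μ) * k) {s t τ : ℝ}
    (hτ : 0 < τ) {S : Set ℝ} (hS : MeasurableSet S) :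
    ∫⁻ z in {z : GSpace d k | τ⁻¹ * grho μ z ∈ S}, ENNReal.ofReal (wt μ s t z) =
      ENNReal.ofReal (τ ^ (Q + t)) *
        ∫⁻ z in {z : GSpace d k | grho μ z ∈ S}, ENNReal.ofReal (wt μ s t z) := by
  have hτ' : 0 < τ⁻¹ := inv_pos.2 hτ
  have hm1 := measurableSet_grho_preimage (d := d) (k := k) hμ hS
  have hm2 : MeasurableSet {z : GSpace d k | τ⁻¹ * grho μ z ∈ S} :=
    (((continuous_grho (d := d) (k := k) hμ).measurable.const_mul τ⁻¹)) hS
  have h := lintegral_comp_dil (ν := 1 + μ) hτ' ({z : GSpace d k | grho μ z ∈ S}.indicator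
    fun z => ENNReal.ofReal (wt μ s t z))
  rw [lintegral_indicator hm1, ← hQ] at h
  have e : ∀ z, {z : GSpace d k | grho μ z ∈ S}.indicator
      (fun z => ENNReal.ofReal (wt μ s t z)) (dil (1 + μ) τ⁻¹ z) =
      ENNReal.ofReal (τ ^ (-t)) * {z : GSpace d k | τ⁻¹ * grho μ z ∈ S}.indicator
      (fun z => ENNReal.ofReal (wt μ s t z)) z := by
    intro z
    have hiff : dil (1 + μ) τ⁻¹ z ∈ {z : GSpace d k | grho μ z ∈ S} ↔
        z ∈ {z : GSpace d k | τ⁻¹ * grho μ z ∈ S} := by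
      change grho μ (dil (1 + μ) τ⁻¹ z) ∈ S ↔ _
      rw [grho_dil hμ hτ']
      rfl
    by_cases hz : z ∈ {z : GSpace d k | τ⁻¹ * grho μ z ∈ S}
    · rw [Set.indicator_of_mem (hiff.2 hz), Set.indicator_of_mem hz, wt_dil hμ hτ',
        ← ENNReal.ofReal_mul (by positivity), inv_rpow hτ.le, ← rpow_neg hτ.le]
    · rw [Set.indicator_of_notMem (mt hiff.1 hz), Set.indicator_of_notMem hz, mul_zero]
  simp_rw [e] at h
  rw [lintegral_const_mul' _ _ ENNReal.ofReal_ne_top, lintegral_indicator hm2] at h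
  calc _ = ENNReal.ofReal (τ ^ t) * (ENNReal.ofReal (τ ^ (-t)) *
        ∫⁻ z in {z : GSpace d k | τ⁻¹ * grho μ z ∈ S}, ENNReal.ofReal (wt μ s t z)) := by
        rw [← mul_assoc, ← ENNReal.ofReal_mul (by positivity), ← rpow_add hτ]
        simp
    _ = _ := by
        rw [h, ← mul_assoc, ← ENNReal.ofReal_mul (by positivity), inv_rpow hτ.le, rpow_neg hτ.le,
          inv_inv, ← rpow_add hτ, add_comm]

lemma setLIntegral_wt_annulus_lt_top (hd : 1 ≤ d) (hμ : 0 < μ) {s : ℝ} (t : ℝ)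
    (hs : 0 < d + μ * s) :
    ∫⁻ z in {z : GSpace d k | grho μ z ∈ Set.Icc 1 2}, ENNReal.ofReal (wt μ s t z) < ∞ := by
  set B : Set (GSpace d k) := Metric.ball 0 3 ×ˢ Metric.ball 0 (3 ^ (1 + μ)) with hB
  have hsub : {z : GSpace d k | grho μ z ∈ Set.Icc 1 2} ⊆ B := by
    rintro z ⟨h1, h2⟩
    have h2 : grho μ z < 3 := h2.trans_lt (by norm_num)
    refine ⟨?_, ?_⟩
    · rw [mem_ball_zero_iff]
      exact (norm_fst_le_grho hμ z).trans_lt h2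
    · rw [mem_ball_zero_iff]
      exact (norm_snd_le_grho hμ z).trans_lt
        (rpow_lt_rpow (grho_nonneg z) h2 (by linarith))
  have hm := measurableSet_grho_preimage (d := d) (k := k) hμ (measurableSet_Icc (a := 1) (b := 2))
  calc ∫⁻ z in {z : GSpace d k | grho μ z ∈ Set.Icc 1 2}, ENNReal.ofReal (wt μ s t z)
      ≤ ∫⁻ z in {z : GSpace d k | grho μ z ∈ Set.Icc 1 2},
        ENNReal.ofReal (2 ^ |t - μ * s|) * ENNReal.ofReal (‖z.1‖ ^ (μ * s)) := by
        refine setLIntegral_mono' hm fun z hz => ?_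
        have hz1 : 1 ≤ grho μ z := hz.1
        have hz2 : grho μ z ≤ 2 := hz.2
        have hz0 : 0 < grho μ z := by linarith
        rw [← ENNReal.ofReal_mul (by positivity)]
        refine ENNReal.ofReal_le_ofReal ?_
        have e : wt μ s t z = grho μ z ^ (t - μ * s) * ‖z.1‖ ^ (μ * s) := by
          rw [wt, ang, div_rpow (by positivity) (by positivity), ← rpow_mul (norm_nonneg _),
            ← rpow_mul hz0.le, rpow_sub hz0]
          ring
        rw [e]
        gcongr
        calc grho μ z ^ (t - μ * s) ≤ grho μ z ^ |t - μ * s| :=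
              rpow_le_rpow_of_exponent_le hz1 (le_abs_self _)
          _ ≤ _ := rpow_le_rpow hz0.le hz2 (abs_nonneg _)
    _ ≤ ∫⁻ z in B, ENNReal.ofReal (2 ^ |t - μ * s|) * ENNReal.ofReal (‖z.1‖ ^ (μ * s)) :=
        lintegral_mono_set hsub
    _ = ENNReal.ofReal (2 ^ |t - μ * s|) *
        ((∫⁻ x in Metric.ball (0 : EuclideanSpace ℝ (Fin d)) 3, ENNReal.ofReal (‖x‖ ^ (μ * s))) *
          ∫⁻ _ in Metric.ball (0 : EuclideanSpace ℝ (Fin k)) (3 ^ (1 + μ)), 1) := by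
        rw [lintegral_const_mul' _ _ ENNReal.ofReal_ne_top, hB, Measure.volume_eq_prod,
          ← Measure.prod_restrict, ← lintegral_prod_mul (by fun_prop) (by fun_prop)]
        simp
    _ < ∞ := by
        refine ENNReal.mul_lt_top ENNReal.ofReal_lt_top
          (ENNReal.mul_lt_top (setLIntegral_ball_rpow_lt_top hd hs 3) ?_)
        rw [setLIntegral_one]
        exact measure_ball_lt_top

lemma setLIntegral_wt_dyadic_lt_top (hd : 1 ≤ d) (hμ : 0 < μ) {Q : ℝ}
    (hQ : Q = d + (1 + μ) * k) {s t : ℝ} (hs : 0 < d + μ * s) {τ₀ τ : ℝ} (hτ₀ : 0 < τ₀)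
    (hτ : 0 < τ) (hc : τ ^ (Q + t) < 1) {U : Set (GSpace d k)}
    (hU : ∀ z ∈ U, z.1 ≠ 0 → ∃ n : ℕ, (τ₀ * τ ^ n)⁻¹ * grho μ z ∈ Set.Icc 1 2) :
    ∫⁻ z in U, ENNReal.ofReal (wt μ s t z) < ∞ := by
  have hU' : U ≤ᵐ[volume] ⋃ n : ℕ, {z : GSpace d k | (τ₀ * τ ^ n)⁻¹ * grho μ z ∈ Set.Icc 1 2} := by
    filter_upwards [ae_fst_ne_zero (k := k) hd] with z hz hzU
    exact Set.mem_iUnion.2 (hU z hzU hz)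
  have hA := setLIntegral_wt_annulus_lt_top (k := k) hd hμ t hs
  set A := ∫⁻ z in {z : GSpace d k | grho μ z ∈ Set.Icc 1 2}, ENNReal.ofReal (wt μ s t z)
  calc ∫⁻ z in U, ENNReal.ofReal (wt μ s t z)
      ≤ ∫⁻ z in ⋃ n : ℕ, {z : GSpace d k | (τ₀ * τ ^ n)⁻¹ * grho μ z ∈ Set.Icc 1 2},
          ENNReal.ofReal (wt μ s t z) := lintegral_mono' (Measure.restrict_mono_ae hU') le_rfl
    _ ≤ ∑' n : ℕ, ∫⁻ z in {z : GSpace d k | (τ₀ * τ ^ n)⁻¹ * grho μ z ∈ Set.Icc 1 2},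
          ENNReal.ofReal (wt μ s t z) := lintegral_iUnion_le _ _
    _ = ∑' n : ℕ, ENNReal.ofReal (τ₀ ^ (Q + t)) * A * ENNReal.ofReal (τ ^ (Q + t)) ^ n := by
        refine tsum_congr fun n => ?_
        rw [setLIntegral_wt_scale hμ hQ (by positivity) measurableSet_Icc,
          mul_rpow hτ₀.le (by positivity), ENNReal.ofReal_mul (by positivity),
          ← ENNReal.ofReal_pow (by positivity), ← rpow_natCast, ← rpow_natCast,
          ← rpow_mul hτ.le, ← rpow_mul hτ.le, mul_comm (n : ℝ)]
        ring
    _ = ENNReal.ofReal (τ₀ ^ (Q + t)) * A * (1 - ENNReal.ofReal (τ ^ (Q + t)))⁻¹ := by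
        rw [ENNReal.tsum_mul_left, ENNReal.tsum_geometric]
    _ < ∞ := by
        refine ENNReal.mul_lt_top (ENNReal.mul_lt_top ENNReal.ofReal_lt_top hA) ?_
        rw [ENNReal.inv_lt_top, tsub_pos_iff_lt]
        simpa using hc

lemma setLIntegral_wt_Iio_lt_top (hd : 1 ≤ d) (hμ : 0 < μ) {Q : ℝ} (hQ : Q = d + (1 + μ) * k)
    {s t : ℝ} (hs : 0 < d + μ * s) (ht : 0 < Q + t) :
    ∫⁻ z in {z : GSpace d k | grho μ z ∈ Set.Iio 1}, ENNReal.ofReal (wt μ s t z) < ∞ := by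
  refine setLIntegral_wt_dyadic_lt_top hd hμ hQ hs (τ₀ := 2⁻¹) (τ := 2⁻¹) (by norm_num)
    (by norm_num) (rpow_lt_one (by norm_num) (by norm_num) ht) fun z hz hz0 => ?_
  have hz1 : grho μ z < 1 := hz
  obtain ⟨n, hn1, hn2⟩ := exists_nat_pow_near_of_lt_one (grho_pos hz0) hz1.le (y := (2⁻¹ : ℝ))
    (by norm_num) (by norm_num)
  rw [pow_succ'] at hn1
  refine ⟨n, ?_, ?_⟩
  · rw [inv_mul_eq_div, le_div_iff₀ (by positivity), one_mul]
    exact hn1.le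
  · rw [inv_mul_eq_div, div_le_iff₀ (by positivity)]
    linarith

lemma setLIntegral_wt_Ici_lt_top (hd : 1 ≤ d) (hμ : 0 < μ) {Q : ℝ} (hQ : Q = d + (1 + μ) * k)
    {s t : ℝ} (hs : 0 < d + μ * s) (ht : Q + t < 0) :
    ∫⁻ z in {z : GSpace d k | grho μ z ∈ Set.Ici 1}, ENNReal.ofReal (wt μ s t z) < ∞ := by
  refine setLIntegral_wt_dyadic_lt_top hd hμ hQ hs (τ₀ := 1) (τ := 2) one_pos two_pos
    (rpow_lt_one_of_one_lt_of_neg one_lt_two ht) fun z hz hz0 => ?_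
  have hz1 : 1 ≤ grho μ z := hz
  obtain ⟨n, hn1, hn2⟩ := exists_nat_pow_near hz1 one_lt_two
  refine ⟨n, ?_, ?_⟩
  · rw [one_mul, inv_mul_eq_div, le_div_iff₀ (by positivity), one_mul]; exact hn1
  · rw [one_mul, inv_mul_eq_div, div_le_iff₀ (by positivity), ← pow_succ']; exact hn2.le

/-- Weighted powers of continuous functions with compact support have finite integral. -/
lemma lintegral_wt_mul_rpow_lt_top (hd : 1 ≤ d) (hμ : 0 < μ) {Q : ℝ} (hQ : Q = d + (1 + μ) * k)
    {s t r : ℝ} (hr : 0 < r) (hs : 0 < d + μ * (s * r)) (ht : 0 < Q + t * r)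
    {f : GSpace d k → ℝ} (hf : Continuous f) (hfc : HasCompactSupport f) :
    ∫⁻ z, ENNReal.ofReal (wt μ s t z * |f z|) ^ r < ∞ := by
  obtain ⟨M, hM⟩ := hfc.exists_bound_of_continuous hf
  have hM0 : 0 ≤ M := (norm_nonneg _).trans (hM 0)
  obtain ⟨R, hR⟩ := hfc.isCompact.bddAbove_image (continuous_grho (d := d) (k := k) hμ).continuousOn
  set R' := |R| + 1 with hR'
  have hR0 : 0 < R' := by positivity
  set E := {z : GSpace d k | R'⁻¹ * grho μ z ∈ Set.Iio 1} with hE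
  have hEm : MeasurableSet E :=
    (((continuous_grho (d := d) (k := k) hμ).measurable.const_mul R'⁻¹)) measurableSet_Iio
  calc ∫⁻ z, ENNReal.ofReal (wt μ s t z * |f z|) ^ r
      ≤ ∫⁻ z, E.indicator
          (fun z => ENNReal.ofReal (M ^ r) * ENNReal.ofReal (wt μ (s * r) (t * r) z)) z := by
        refine lintegral_mono fun z => ?_
        dsimp only
        by_cases hz : z ∈ E
        · rw [Set.indicator_of_mem hz, ← ENNReal.ofReal_mul (by positivity), ← wt_rpow,
            ENNReal.ofReal_rpow_of_nonneg (mul_nonneg (wt_nonneg _ _ _) (abs_nonneg _)) hr.le,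
            mul_rpow (wt_nonneg _ _ _) (abs_nonneg _), mul_comm]
          refine ENNReal.ofReal_le_ofReal (mul_le_mul_of_nonneg_right ?_
            (rpow_nonneg (wt_nonneg _ _ _) _))
          exact rpow_le_rpow (abs_nonneg _) (hM z) hr.le
        · have : f z = 0 := by
            by_contra h
            have h1 := hR (Set.mem_image_of_mem _ (subset_tsupport f h))
            apply hz
            change R'⁻¹ * grho μ z < 1
            rw [inv_mul_lt_one₀ hR0, hR']
            linarith [le_abs_self R]
          simp [this, hr]
    _ = ENNReal.ofReal (M ^ r) * (ENNReal.ofReal (R' ^ (Q + t * r)) *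
          ∫⁻ z in {z : GSpace d k | grho μ z ∈ Set.Iio 1},
            ENNReal.ofReal (wt μ (s * r) (t * r) z)) := by
        rw [lintegral_indicator hEm, lintegral_const_mul' _ _ ENNReal.ofReal_ne_top, hE,
          setLIntegral_wt_scale hμ hQ hR0 measurableSet_Iio]
    _ < ∞ := ENNReal.mul_lt_top ENNReal.ofReal_lt_top (ENNReal.mul_lt_top ENNReal.ofReal_lt_top
        (setLIntegral_wt_Iio_lt_top hd hμ hQ hs ht))

lemma hasCompactSupport_gradMuNorm {u : GSpace d k → ℝ} (hu : ContDiff ℝ 1 u)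
    (huc : HasCompactSupport u) : HasCompactSupport (gradMuNorm μ u) := by
  refine HasCompactSupport.intro huc.isCompact fun z hz => ?_
  have h : fderiv ℝ u z = 0 := by
    have := notMem_tsupport_iff_eventuallyEq.1 hz
    rw [this.fderiv_eq]
    simp
  refine le_antisymm (gradMuNorm_le (hu.differentiable one_ne_zero z) le_rfl fun a b => ?_)
    (gradMuNorm_nonneg _ _)
  simp [h]

end Integrability

section Core

variable {d k : ℕ} {μ : ℝ}

/-- The weighted integral `∫ (|x|^μ/ρ^μ)^{sr} ρ^{tr} |f|^r`. -/
noncomputable def wint (μ s t r : ℝ) (f : GSpace d k → ℝ) : ℝ≥0∞ :=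
  ∫⁻ z, ENNReal.ofReal (wt μ s t z * |f z|) ^ r

lemma wint_sub_comp_dil_le (hμ : 0 < μ) {s t r l : ℝ} (hl : 0 < l) (hr : 0 ≤ r)
    {f : GSpace d k → ℝ} (hf : Continuous f) :
    wint μ s t r (fun z => f z - f (dil (1 + μ) l z)) ≤
      2 ^ r * (1 + ENNReal.ofReal (l ^ (-(d + (1 + μ) * k + t * r)))) * wint μ s t r f := by
  have h := ENNReal.lintegral_rpow_le_two_rpow_mul (m := volume) (r := r)
    (f := fun z : GSpace d k => ENNReal.ofReal (wt μ s t z * |f z - f (dil (1 + μ) l z)|))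
    (g := fun z => ENNReal.ofReal (wt μ s t z * |f z|))
    (g' := fun z => ENNReal.ofReal (wt μ s t z * |f (dil (1 + μ) l z)|)) (fun z => by
      have h0 := wt_nonneg (μ := μ) s t z
      rw [← ENNReal.ofReal_add (by positivity) (by positivity), ← mul_add]
      exact ENNReal.ofReal_le_ofReal (mul_le_mul_of_nonneg_left (abs_sub _ _) h0))
    ((measurable_wt hμ s t).mul hf.abs.measurable).ennreal_ofReal hr
  rw [lintegral_weight_comp_dil hl hr (fun z => wt_dil hμ hl z) (fun z => |f z|)] at h
  refine h.trans_eq ?_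
  simp only [wint]
  ring

lemma wint_gradMuNorm_sub_comp_dil_le (hμ : 0 < μ) {t r l : ℝ} (hl : 1 ≤ l) (hr : 0 ≤ r)
    {u : GSpace d k → ℝ} (hu : ContDiff ℝ 1 u) :
    wint μ 0 t r (gradMuNorm μ fun z => u z - u (dil (1 + μ) l z)) ≤
      2 ^ r * (1 + ENNReal.ofReal l ^ r * ENNReal.ofReal (l ^ (-(d + (1 + μ) * k + t * r)))) *
        wint μ 0 t r (gradMuNorm μ u) := by
  have hl0 : 0 < l := by linarith
  have hG := continuous_gradMuNorm hμ hu
  have h := ENNReal.lintegral_rpow_le_two_rpow_mul (m := volume) (r := r)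
    (f := fun z : GSpace d k => ENNReal.ofReal (wt μ 0 t z *
      |gradMuNorm μ (fun z => u z - u (dil (1 + μ) l z)) z|))
    (g := fun z => ENNReal.ofReal (wt μ 0 t z * |gradMuNorm μ u z|))
    (g' := fun z => ENNReal.ofReal l *
      ENNReal.ofReal (wt μ 0 t z * |gradMuNorm μ u (dil (1 + μ) l z)|)) (fun z => by
      have h0 := wt_nonneg (μ := μ) 0 t z
      rw [← ENNReal.ofReal_mul hl0.le, ← ENNReal.ofReal_add (by positivity) (by positivity)]
      refine ENNReal.ofReal_le_ofReal ?_
      rw [mul_left_comm, ← mul_add]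
      refine mul_le_mul_of_nonneg_left ?_ h0
      simp only [abs_of_nonneg (gradMuNorm_nonneg _ _)]
      refine (gradMuNorm_sub_le (hu.differentiable one_ne_zero z)
        ((hu.comp_dil hl0).differentiable one_ne_zero z)).trans ?_
      gcongr
      exact gradMuNorm_comp_dil_le hl le_rfl (hu.differentiable one_ne_zero _))
    ((measurable_wt hμ 0 t).mul hG.abs.measurable).ennreal_ofReal hr
  simp_rw [ENNReal.mul_rpow_of_nonneg _ _ hr] at h
  rw [lintegral_const_mul' _ _ (by finiteness),
    lintegral_weight_comp_dil hl0 hr (fun z => wt_dil hμ hl0 z) (fun z => |gradMuNorm μ u z|)] at h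
  refine h.trans_eq ?_
  simp only [wint]
  ring

lemma exists_wint_one_sub_comp_dil_le (hd : 1 ≤ d) (hμ : 0 < μ) {α p l : ℝ} (hl : 1 ≤ l)
    (hp : 1 ≤ p) :
    ∃ C : ℝ≥0∞, C ≠ ∞ ∧ ∀ u : GSpace d k → ℝ, ContDiff ℝ 1 u →
      wint μ 1 (α - 1) p (fun z => u z - u (dil (1 + μ) l z)) ≤
        C * wint μ 0 α p (gradMuNorm μ u) := by
  obtain ⟨C, hC, H⟩ := exists_lintegral_sub_comp_dil_le (d := d) (k := k) hl hp
    (W := wt μ 1 (α - 1)) (wt_nonneg 1 (α - 1)) (measurable_wt hμ 1 (α - 1))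
    (fun τ hτ z => wt_dil hμ hτ z)
  refine ⟨C, hC, fun u hu => (H u hu).trans (mul_le_mul_right (lintegral_mono_ae ?_) C)⟩
  filter_upwards [ae_fst_ne_zero (k := k) hd] with z hz
  refine ENNReal.rpow_le_rpow (ENNReal.ofReal_le_ofReal ?_) (by linarith)
  calc wt μ 1 (α - 1) z * |eulerDeriv (1 + μ) u z|
      ≤ wt μ 1 (α - 1) z * (wt μ (-1) 1 z * gradMuNorm μ u z) :=
        mul_le_mul_of_nonneg_left
          (abs_eulerDeriv_le_gradMuNorm hμ (hu.differentiable one_ne_zero) hz) (wt_nonneg _ _ _)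
    _ = _ := by
        rw [← mul_assoc, wt_mul_wt hz, abs_of_nonneg (gradMuNorm_nonneg _ _)]
        norm_num

lemma exists_wint_sobolev_sub_comp_dil_le (hd : 1 ≤ d) (hk : 1 ≤ k) (hμ : 0 < μ) {Q p : ℝ}
    (hQ : Q = d + (1 + μ) * k) (hp : 1 < p) (hpQ : p < Q) (α : ℝ) {l : ℝ} (hl : 1 ≤ l) :
    ∃ C : ℝ≥0∞, C ≠ ∞ ∧ ∀ u : GSpace d k → ℝ, ContDiff ℝ 1 u → HasCompactSupport u →
      wint μ 0 α (p * Q / (Q - p)) (fun z => u z - u (dil (1 + μ) l z)) ^ (1 / p - 1 / Q) ≤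
        C * wint μ 0 α p (gradMuNorm μ u) ^ (1 / p) := by
  have hl0 : 0 < l := by linarith
  have hp' : 0 ≤ 1 / p := by positivity
  obtain ⟨C, hC, H⟩ := exists_weighted_sobolev hd hk hμ hQ hp hpQ α
  obtain ⟨C₁, hC₁, H₁⟩ := exists_wint_one_sub_comp_dil_le (k := k) hd hμ (α := α) hl hp.le
  set C₂ : ℝ≥0∞ := 2 ^ p *
    (1 + ENNReal.ofReal l ^ p * ENNReal.ofReal (l ^ (-(d + (1 + μ) * k + α * p)))) with hC₂
  have hC₂' : C₂ ≠ ∞ := by rw [hC₂]; finiteness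
  refine ⟨C * (C₂ ^ (1 / p) + C₁ ^ (1 / p)), by finiteness, fun u hu huc => ?_⟩
  refine (H _ (hu.sub (hu.comp_dil hl0)) (huc.sub (huc.comp_dil hl0))).trans ?_
  rw [mul_assoc, add_mul, ← ENNReal.mul_rpow_of_nonneg _ _ hp',
    ← ENNReal.mul_rpow_of_nonneg _ _ hp']
  refine mul_le_mul_right (add_le_add (ENNReal.rpow_le_rpow ?_ hp')
    (ENNReal.rpow_le_rpow (H₁ u hu) hp')) C
  refine le_trans (le_of_eq ?_)
    (wint_gradMuNorm_sub_comp_dil_le hμ (t := α) (r := p) hl (by linarith) hu)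
  simp only [wint, abs_of_nonneg (gradMuNorm_nonneg _ _)]

lemma wint_holder (hd : 1 ≤ d) (hμ : 0 < μ) {α β γ r p₁ p₂ p₃ θ₁ θ₂ θ₃ : ℝ} (hp₁ : 0 < p₁)
    (hp₂ : 0 < p₂) (hp₃ : 0 < p₃) (hr : 0 < r)
    (h₁ : 0 ≤ θ₁) (h₂ : 0 ≤ θ₂) (h₃ : 0 ≤ θ₃) (hsum : θ₁ + θ₂ + θ₃ = 1)
    (hγ : γ = θ₁ * (α - 1) + θ₂ * α + θ₃ * β) (hbal : 1 / r = θ₁ / p₁ + θ₂ / p₂ + θ₃ / p₃)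
    {w : GSpace d k → ℝ} (hw : Continuous w) :
    wint μ (α - γ) γ r w ^ (1 / r) ≤ wint μ 1 (α - 1) p₁ w ^ (θ₁ / p₁) *
      wint μ 0 α p₂ w ^ (θ₂ / p₂) * wint μ (α - β) β p₃ w ^ (θ₃ / p₃) := by
  have hm : ∀ s t p : ℝ, Measurable fun z : GSpace d k => ENNReal.ofReal (wt μ s t z * |w z|) ^ p :=
    fun s t p => ((measurable_wt hμ s t).mul hw.abs.measurable).ennreal_ofReal.pow_const p
  set f : Fin 3 → GSpace d k → ℝ≥0∞ := ![fun z => ENNReal.ofReal (wt μ 1 (α - 1) z * |w z|) ^ p₁,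
    fun z => ENNReal.ofReal (wt μ 0 α z * |w z|) ^ p₂,
    fun z => ENNReal.ofReal (wt μ (α - β) β z * |w z|) ^ p₃] with hf
  have hr1 : r * (θ₁ / p₁ + θ₂ / p₂ + θ₃ / p₃) = 1 := by rw [← hbal, mul_one_div_cancel hr.ne']
  have key := ENNReal.lintegral_prod_norm_pow_le (μ := volume) Finset.univ (f := f)
    (p := ![r * (θ₁ / p₁), r * (θ₂ / p₂), r * (θ₃ / p₃)])
    (by intro i _; fin_cases i <;> exact (hm _ _ _).aemeasurable)
    (by simp only [Fin.sum_univ_three]; simpa [mul_add] using hr1)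
    (by intro i _; fin_cases i <;> simp <;> positivity)
  simp only [Fin.prod_univ_three] at key
  change ∫⁻ z, (ENNReal.ofReal (wt μ 1 (α - 1) z * |w z|) ^ p₁) ^ (r * (θ₁ / p₁)) *
    (ENNReal.ofReal (wt μ 0 α z * |w z|) ^ p₂) ^ (r * (θ₂ / p₂)) *
    (ENNReal.ofReal (wt μ (α - β) β z * |w z|) ^ p₃) ^ (r * (θ₃ / p₃)) ≤
    wint μ 1 (α - 1) p₁ w ^ (r * (θ₁ / p₁)) * wint μ 0 α p₂ w ^ (r * (θ₂ / p₂)) *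
      wint μ (α - β) β p₃ w ^ (r * (θ₃ / p₃)) at key
  have hpt : wint μ (α - γ) γ r w ≤
      ∫⁻ z, (ENNReal.ofReal (wt μ 1 (α - 1) z * |w z|) ^ p₁) ^ (r * (θ₁ / p₁)) *
        (ENNReal.ofReal (wt μ 0 α z * |w z|) ^ p₂) ^ (r * (θ₂ / p₂)) *
        (ENNReal.ofReal (wt μ (α - β) β z * |w z|) ^ p₃) ^ (r * (θ₃ / p₃)) := by
    refine lintegral_mono_ae ?_
    filter_upwards [ae_fst_ne_zero (k := k) hd] with z hz
    have hn : ∀ s t : ℝ, 0 ≤ wt μ s t z * |w z| := fun s t =>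
      mul_nonneg (wt_nonneg _ _ _) (abs_nonneg _)
    simp only [← ENNReal.rpow_mul]
    rw [show p₁ * (r * (θ₁ / p₁)) = θ₁ * r by field_simp,
      show p₂ * (r * (θ₂ / p₂)) = θ₂ * r by field_simp,
      show p₃ * (r * (θ₃ / p₃)) = θ₃ * r by field_simp]
    simp only [ENNReal.rpow_mul]
    rw [← ENNReal.mul_rpow_of_nonneg _ _ hr.le, ← ENNReal.mul_rpow_of_nonneg _ _ hr.le,
      ENNReal.ofReal_rpow_of_nonneg (hn _ _) h₁, ENNReal.ofReal_rpow_of_nonneg (hn _ _) h₂,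
      ENNReal.ofReal_rpow_of_nonneg (hn _ _) h₃, ← ENNReal.ofReal_mul (rpow_nonneg (hn _ _) _),
      ← ENNReal.ofReal_mul (mul_nonneg (rpow_nonneg (hn _ _) _) (rpow_nonneg (hn _ _) _))]
    refine ENNReal.rpow_le_rpow (ENNReal.ofReal_le_ofReal (le_of_eq ?_)) hr.le
    simp only [mul_rpow (wt_nonneg _ _ _) (abs_nonneg _), wt_rpow]
    have hx : |w z| = |w z| ^ θ₁ * |w z| ^ θ₂ * |w z| ^ θ₃ := by
      rw [← rpow_add_of_nonneg (abs_nonneg _) h₁ h₂,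
        ← rpow_add_of_nonneg (abs_nonneg _) (add_nonneg h₁ h₂) h₃, hsum, rpow_one]
    have hW : wt μ (α - γ) γ z = wt μ (1 * θ₁) ((α - 1) * θ₁) z * wt μ (0 * θ₂) (α * θ₂) z *
        wt μ ((α - β) * θ₃) (β * θ₃) z := by
      rw [wt_mul_wt hz, wt_mul_wt hz]
      congr 1
      · rw [hγ]; linear_combination (-α) * hsum
      · rw [hγ]; ring
    rw [hW]
    nth_rewrite 1 [hx]
    ring
  refine (ENNReal.rpow_le_rpow (hpt.trans key) (by positivity)).trans_eq ?_
  simp only [ENNReal.mul_rpow_of_nonneg _ _ (show 0 ≤ 1 / r by positivity), ← ENNReal.rpow_mul]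
  have hr' : ∀ x : ℝ, r * x * (1 / r) = x := fun x => by field_simp
  simp only [hr']

/-- The inequality for weights which are convex combinations of the endpoint weights of the
Hardy, Sobolev and trivial inequalities. -/
lemma exists_wint_le_of_convex (hd : 1 ≤ d) (hk : 1 ≤ k) (hμ : 0 < μ) {Q : ℝ}
    (hQ : Q = d + (1 + μ) * k) {p q r α β γ θ₁ θ₂ θ₃ : ℝ} (hp : 1 < p) (hpQ : p < Q)
    (hq : 1 ≤ q) (hr : 0 < r) (h₁ : 0 ≤ θ₁) (h₂ : 0 ≤ θ₂) (h₃ : 0 ≤ θ₃) (hsum : θ₁ + θ₂ + θ₃ = 1)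
    (hγ : γ = θ₁ * (α - 1) + θ₂ * α + θ₃ * β)
    (hbal : 1 / r = θ₁ / p + θ₂ * (1 / p - 1 / Q) + θ₃ / q) (hs : 0 < Q + γ * r) :
    ∃ C : ℝ≥0∞, C ≠ ∞ ∧ ∀ u : GSpace d k → ℝ, ContDiff ℝ 1 u → HasCompactSupport u →
      wint μ (α - γ) γ r u ≠ ∞ →
      wint μ (α - γ) γ r u ^ (1 / r) ≤
        C * wint μ 0 α p (gradMuNorm μ u) ^ ((θ₁ + θ₂) / p) *
          wint μ (α - β) β q u ^ (θ₃ / q) := by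
  obtain ⟨l, hl, hlarge⟩ : ∃ l : ℝ, 1 ≤ l ∧ (2 : ℝ) ^ (r + 1) ≤ l ^ (Q + γ * r) :=
    (((Filter.eventually_ge_atTop 1).and
      ((tendsto_rpow_atTop hs).eventually_ge_atTop ((2 : ℝ) ^ (r + 1)))).exists)
  have hl0 : 0 < l := by linarith
  have hp0 : 0 < p := by linarith
  have hq0 : 0 < q := by linarith
  have hQp : 0 < Q - p := by linarith
  have hQ0 : 0 < Q := by linarith
  have hP : 0 < p * Q / (Q - p) := by positivity
  have hPe : θ₂ / (p * Q / (Q - p)) = (1 / p - 1 / Q) * θ₂ := by field_simp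
  obtain ⟨C₁, hC₁, H₁⟩ := exists_wint_one_sub_comp_dil_le (k := k) hd hμ (α := α) hl hp.le
  obtain ⟨C₂, hC₂, H₂⟩ := exists_wint_sobolev_sub_comp_dil_le hd hk hμ hQ hp hpQ α hl
  set C₃ : ℝ≥0∞ := 2 ^ q * (1 + ENNReal.ofReal (l ^ (-(d + (1 + μ) * k + β * q)))) with hC₃
  have hC₃' : C₃ ≠ ∞ := by rw [hC₃]; finiteness
  have e1 : 0 ≤ θ₁ / p := by positivity
  have e2 : 0 ≤ 1 / r := by positivity
  have e3 : 0 ≤ θ₃ / q := by positivity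
  refine ⟨(2 ^ (r + 1)) ^ (1 / r) * (C₁ ^ (θ₁ / p) * C₂ ^ θ₂ * C₃ ^ (θ₃ / q)), by finiteness,
    fun u hu huc hfin => ?_⟩
  set w : GSpace d k → ℝ := fun z => u z - u (dil (1 + μ) l z) with hw
  have hwc : Continuous w := (hu.sub (hu.comp_dil hl0)).continuous
  set I := wint μ 0 α p (gradMuNorm μ u)
  set J := wint μ (α - β) β q u
  have k1 : wint μ (α - γ) γ r u ≤ 2 ^ (r + 1) * wint μ (α - γ) γ r w :=
    lintegral_le_lintegral_sub_comp_dil hl0 hr (by rw [← hQ]; exact hlarge) (wt_nonneg _ _)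
      (measurable_wt hμ _ _) (fun z => wt_dil hμ hl0 z) hu.continuous hfin
  have k2 := wint_holder (γ := γ) hd hμ hp0 hP hq0 hr h₁ h₂ h₃ hsum hγ
    (by rw [hPe, hbal]; ring) hwc
  rw [hPe, ENNReal.rpow_mul] at k2
  calc wint μ (α - γ) γ r u ^ (1 / r) ≤ (2 ^ (r + 1) * wint μ (α - γ) γ r w) ^ (1 / r) :=
        ENNReal.rpow_le_rpow k1 e2
    _ = (2 ^ (r + 1)) ^ (1 / r) * wint μ (α - γ) γ r w ^ (1 / r) :=
        ENNReal.mul_rpow_of_nonneg _ _ e2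
    _ ≤ (2 ^ (r + 1)) ^ (1 / r) *
        ((C₁ * I) ^ (θ₁ / p) * (C₂ * I ^ (1 / p)) ^ θ₂ * (C₃ * J) ^ (θ₃ / q)) := by
        refine mul_le_mul_right (k2.trans (mul_le_mul' (mul_le_mul' ?_ ?_) ?_)) _
        · exact ENNReal.rpow_le_rpow (H₁ u hu) e1
        · exact ENNReal.rpow_le_rpow (H₂ u hu huc) h₂
        · exact ENNReal.rpow_le_rpow (wint_sub_comp_dil_le hμ hl0 hq0.le hu.continuous) e3
    _ = _ := by
        rw [ENNReal.mul_rpow_of_nonneg _ _ e1, ENNReal.mul_rpow_of_nonneg _ _ h₂,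
          ENNReal.mul_rpow_of_nonneg _ _ e3,
          show (θ₁ + θ₂) / p = θ₁ / p + 1 / p * θ₂ by ring,
          ENNReal.rpow_add_of_nonneg _ _ e1 (by positivity), ENNReal.rpow_mul I]
        ring

end Core

section Interpolation

variable {d k : ℕ} {μ : ℝ}

lemma setLIntegral_wt_mul_rpow_le (hd : 1 ≤ d) (hμ : 0 < μ) {s t s' t' r r' m : ℝ}
    (hr : 0 < r) (hr' : 0 < r') (hm : 0 < m) (hbal : 1 / r = 1 / r' + 1 / m)
    {u : GSpace d k → ℝ} (hu : Continuous u) (Ω : Set (GSpace d k)) :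
    (∫⁻ z in Ω, ENNReal.ofReal (wt μ s t z * |u z|) ^ r) ^ (1 / r) ≤
      wint μ s' t' r' u ^ (1 / r') *
        (∫⁻ z in Ω, ENNReal.ofReal (wt μ ((s - s') * m) ((t - t') * m) z)) ^ (1 / m) := by
  have hr1 : r / r' + r / m = 1 := by
    rw [div_eq_mul_one_div r r', div_eq_mul_one_div r m, ← mul_add, ← hbal,
      mul_one_div_cancel hr.ne']
  have hF : Measurable fun z : GSpace d k => ENNReal.ofReal (wt μ s' t' z * |u z|) ^ r' :=
    ((measurable_wt hμ s' t').mul hu.abs.measurable).ennreal_ofReal.pow_const r'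
  have hG : Measurable fun z : GSpace d k =>
      ENNReal.ofReal (wt μ ((s - s') * m) ((t - t') * m) z) :=
    (measurable_wt hμ _ _).ennreal_ofReal
  have hle : ∫⁻ z in Ω, ENNReal.ofReal (wt μ s t z * |u z|) ^ r ≤
      ∫⁻ z in Ω, (ENNReal.ofReal (wt μ s' t' z * |u z|) ^ r') ^ (r / r') *
        ENNReal.ofReal (wt μ ((s - s') * m) ((t - t') * m) z) ^ (r / m) := by
    refine lintegral_mono_ae (ae_restrict_of_ae ?_)
    filter_upwards [ae_fst_ne_zero (k := k) hd] with z hz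
    have h1 := wt_nonneg (μ := μ) s' t' z
    have h2 := wt_nonneg (μ := μ) (s - s') (t - t') z
    rw [← wt_rpow, ← ENNReal.ofReal_rpow_of_nonneg h2 hm.le, ← ENNReal.rpow_mul,
      ← ENNReal.rpow_mul, mul_div_cancel₀ _ hr'.ne', mul_div_cancel₀ _ hm.ne',
      ← ENNReal.mul_rpow_of_nonneg _ _ hr.le, ← ENNReal.ofReal_mul (by positivity),
      mul_right_comm, wt_mul_wt hz, add_sub_cancel, add_sub_cancel]
  have hH := ENNReal.lintegral_mul_norm_pow_le (μ := volume.restrict Ω) hF.aemeasurable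
    hG.aemeasurable (by positivity) (by positivity) hr1
  refine (ENNReal.rpow_le_rpow (hle.trans hH) (by positivity)).trans ?_
  rw [ENNReal.mul_rpow_of_nonneg _ _ (by positivity), ← ENNReal.rpow_mul, ← ENNReal.rpow_mul,
    show r / r' * (1 / r) = 1 / r' by field_simp, show r / m * (1 / r) = 1 / m by field_simp]
  exact mul_le_mul_left (ENNReal.rpow_le_rpow (setLIntegral_le_lintegral _ _) (by positivity)) _

lemma le_mul_rpow_of_forall_scale {L K₁ K₂ A B : ℝ≥0∞} (hA : A ≠ ∞) (hB : B ≠ ∞) {a a₁ a₂ D : ℝ}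
    (h₁ : 0 < a₁) (h₁' : a₁ < 1) (h₂ : 0 < a₂) (h₂' : a₂ < 1) (hD : D ≠ 0)
    (H : ∀ R : ℝ, 0 < R → L ≤ K₁ * (A ^ a₁ * B ^ (1 - a₁) * ENNReal.ofReal (R ^ ((a - a₁) * D))) +
      K₂ * (A ^ a₂ * B ^ (1 - a₂) * ENNReal.ofReal (R ^ ((a - a₂) * D)))) :
    L ≤ (K₁ + K₂) * (A ^ a * B ^ (1 - a)) := by
  rcases eq_or_ne A 0 with h0 | h0
  · have := H 1 one_pos
    simp only [h0, ENNReal.zero_rpow_of_pos h₁, ENNReal.zero_rpow_of_pos h₂, zero_mul, mul_zero,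
      add_zero] at this
    exact this.trans zero_le
  rcases eq_or_ne B 0 with h0' | h0'
  · have := H 1 one_pos
    simp only [h0', ENNReal.zero_rpow_of_pos (sub_pos.2 h₁'),
      ENNReal.zero_rpow_of_pos (sub_pos.2 h₂'), zero_mul, mul_zero, add_zero] at this
    exact this.trans zero_le
  have hx : 0 < A.toReal := ENNReal.toReal_pos h0 hA
  have hy : 0 < B.toReal := ENNReal.toReal_pos h0' hB
  rw [← ENNReal.ofReal_toReal hA, ← ENNReal.ofReal_toReal hB] at H ⊢
  set x := A.toReal
  set y := B.toReal
  have key : ∀ b : ℝ, ENNReal.ofReal x ^ b * ENNReal.ofReal y ^ (1 - b) *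
      ENNReal.ofReal (((x / y) ^ (1 / D)) ^ ((a - b) * D)) =
      ENNReal.ofReal x ^ a * ENNReal.ofReal y ^ (1 - a) := by
    intro b
    simp only [ENNReal.ofReal_rpow_of_pos hx, ENNReal.ofReal_rpow_of_pos hy]
    rw [← ENNReal.ofReal_mul (by positivity), ← ENNReal.ofReal_mul (by positivity),
      ← ENNReal.ofReal_mul (by positivity), ← rpow_mul (by positivity),
      show 1 / D * ((a - b) * D) = a - b by field_simp, div_rpow hx.le hy.le]
    congr 1
    rw [rpow_sub hx, rpow_sub hy, rpow_sub hy, rpow_sub hy]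
    field_simp
  have := H ((x / y) ^ (1 / D)) (by positivity)
  rwa [key, key, ← add_mul] at this

lemma exists_setLIntegral_le_of_interpolation (hd : 1 ≤ d) (hk : 1 ≤ k) (hμ : 0 < μ) {Q : ℝ}
    (hQ : Q = d + (1 + μ) * k) {p q r α β γ b : ℝ} (hp : 1 < p) (hpQ : p < Q)
    (hq : 1 ≤ q) (hr : 0 < r) (hβ : 0 < d + μ * (α - β) * q) (hb0 : 0 < b) (hb1 : b < 1)
    (hS : 0 < b * (Q / p + (α - 1)) + (1 - b) * (Q / q + β))
    (hrb : b / p + (1 - b) / q < 1 / r) (hγb : γ < b * (α - 1) + (1 - b) * β)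
    {T : Set ℝ} (hT : MeasurableSet T)
    (hfinT : ∀ s t : ℝ, 0 < d + μ * s →
      0 < (Q + t) * (Q / r + γ - (b * (Q / p + (α - 1)) + (1 - b) * (Q / q + β))) →
      ∫⁻ z in {z : GSpace d k | grho μ z ∈ T}, ENNReal.ofReal (wt μ s t z) < ∞)
    (hne : Q / r + γ - (b * (Q / p + (α - 1)) + (1 - b) * (Q / q + β)) ≠ 0) :
    ∃ C : ℝ≥0∞, C ≠ ∞ ∧ ∀ u : GSpace d k → ℝ, ContDiff ℝ 1 u → HasCompactSupport u →
      ∀ R : ℝ, 0 < R →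
      (∫⁻ z in {z : GSpace d k | R⁻¹ * grho μ z ∈ T},
        ENNReal.ofReal (wt μ (α - γ) γ z * |u z|) ^ r) ^ (1 / r) ≤
        C * ((wint μ 0 α p (gradMuNorm μ u) ^ (1 / p)) ^ b *
          (wint μ (α - β) β q u ^ (1 / q)) ^ (1 - b) *
          ENNReal.ofReal
            (R ^ (Q / r + γ - (b * (Q / p + (α - 1)) + (1 - b) * (Q / q + β))))) := by
  have hp0 : 0 < p := by linarith
  have hq0 : 0 < q := by linarith
  have hb1' : 0 < 1 - b := by linarith
  have hQ0 : 0 < Q := by linarith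
  set e := Q / r + γ - (b * (Q / p + (α - 1)) + (1 - b) * (Q / q + β)) with he
  set γ' := b * (α - 1) + (1 - b) * β with hγ'
  obtain ⟨r', hr'0, hr'⟩ : ∃ r' : ℝ, 0 < r' ∧ 1 / r' = b / p + (1 - b) / q :=
    ⟨1 / (b / p + (1 - b) / q), by positivity, one_div_one_div _⟩
  obtain ⟨m, hm0, hm⟩ : ∃ m : ℝ, 0 < m ∧ 1 / r = 1 / r' + 1 / m :=
    ⟨1 / (1 / r - 1 / r'), one_div_pos.2 (by rw [hr']; linarith),
      by rw [one_div_one_div]; ring⟩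
  have hS' : Q + γ' * r' = r' * (b * (Q / p + (α - 1)) + (1 - b) * (Q / q + β)) := by
    have : Q = r' * (Q * (b / p + (1 - b) / q)) := by rw [← hr']; field_simp
    rw [hγ']
    linear_combination this
  have hs : 0 < Q + γ' * r' := by rw [hS']; positivity
  have hd' : 0 < d + μ * ((α - γ') * r') := by
    have h1 : (d : ℝ) + μ * ((α - γ') * r') =
        r' * (b * (d / p + μ) + (1 - b) / q * (d + μ * (α - β) * q)) := by
      have : (d : ℝ) = r' * (d * (b / p + (1 - b) / q)) := by rw [← hr']; field_simp
      rw [hγ']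
      have h2 : (1 - b) / q * (d + μ * (α - β) * q) =
          (1 - b) * (d / q) + (1 - b) * μ * (α - β) := by
        field_simp
      rw [h2]
      linear_combination this
    rw [h1]
    positivity
  have hem : Q + (γ - γ') * m = m * e := by
    have : Q = m * (Q * (1 / r - 1 / r')) := by rw [hm]; field_simp; ring
    rw [he, hγ']
    rw [hr'] at this
    linear_combination this
  obtain ⟨C, hC, H⟩ := exists_wint_le_of_convex hd hk hμ hQ (r := r') (α := α) (β := β)
    (γ := γ') (θ₁ := b) (θ₂ := 0) (θ₃ := 1 - b) hp hpQ hq hr'0 hb0.le le_rfl hb1'.le (by ring)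
    (by rw [hγ']; ring) (by rw [hr']; ring) hs
  have hK := hfinT ((α - γ - (α - γ')) * m) ((γ - γ') * m)
    (by
      have : 0 < α - γ - (α - γ') := by linarith
      positivity)
    (by
      rw [hem, mul_assoc]
      exact mul_pos hm0 (mul_self_pos.2 hne))
  set K := ∫⁻ z in {z : GSpace d k | grho μ z ∈ T},
    ENNReal.ofReal (wt μ ((α - γ - (α - γ')) * m) ((γ - γ') * m) z)
  have hm1 : 0 ≤ 1 / m := by positivity
  refine ⟨C * K ^ (1 / m), by finiteness, fun u hu huc R hR => ?_⟩
  refine (setLIntegral_wt_mul_rpow_le hd hμ (s' := α - γ') (t' := γ') hr hr'0 hm0 hm hu.continuous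
    _).trans ?_
  rw [setLIntegral_wt_scale hμ hQ hR hT, ENNReal.mul_rpow_of_nonneg _ _ hm1,
    ENNReal.ofReal_rpow_of_nonneg (by positivity) hm1, ← rpow_mul hR.le, hem,
    show m * e * (1 / m) = e by field_simp]
  have h := H u hu huc
    (lintegral_wt_mul_rpow_lt_top hd hμ hQ hr'0 hd' hs hu.continuous huc).ne
  refine (mul_le_mul_left h _).trans_eq ?_
  rw [← ENNReal.rpow_mul, ← ENNReal.rpow_mul, add_zero,
    show 1 / p * b = b / p by ring, show 1 / q * (1 - b) = (1 - b) / q by ring]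
  ring

end Interpolation

section Final

variable {d k : ℕ} {μ : ℝ}

lemma exists_wint_le_of_interpolation (hd : 1 ≤ d) (hk : 1 ≤ k) (hμ : 0 < μ) {Q : ℝ}
    (hQ : Q = d + (1 + μ) * k) {p q r a α β γ : ℝ} (hp : 1 < p) (hpQ : p < Q)
    (hq : 1 ≤ q) (hr : 0 < r) (hβ : 0 < d + μ * (α - β) * q) (hα : 0 < α * p + Q)
    (hβQ : 0 < β * q + Q) (hγQ : 0 < γ * r + Q) (ha0 : 0 < a) (ha1 : a < 1)
    (hbal : Q / r + γ = a * (Q / p + (α - 1)) + (1 - a) * (Q / q + β))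
    (hγ : γ < a * (α - 1) + (1 - a) * β) (hD : Q / p + (α - 1) - (Q / q + β) ≠ 0) :
    ∃ C : ℝ≥0∞, C ≠ ∞ ∧ ∀ u : GSpace d k → ℝ, ContDiff ℝ 1 u → HasCompactSupport u →
      wint μ (α - γ) γ r u ^ (1 / r) ≤
        C * wint μ 0 α p (gradMuNorm μ u) ^ (a / p) * wint μ (α - β) β q u ^ ((1 - a) / q) := by
  have hp0 : 0 < p := by linarith
  have hq0 : 0 < q := by linarith
  have hQ0 : 0 < Q := by linarith
  set D := Q / p + (α - 1) - (Q / q + β) with hDdef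
  have hD2 : 0 < D * D := mul_self_pos.2 hD
  set S : ℝ → ℝ := fun b => b * (Q / p + (α - 1)) + (1 - b) * (Q / q + β) with hS
  have hSa : 0 < S a := by
    change 0 < a * (Q / p + (α - 1)) + (1 - a) * (Q / q + β)
    rw [← hbal, show Q / r + γ = (γ * r + Q) / r by field_simp; ring]
    positivity
  have hra : a / p + (1 - a) / q < 1 / r := by
    have : Q * (1 / r - (a / p + (1 - a) / q)) = a * (α - 1) + (1 - a) * β - γ := by
      linear_combination hbal
    have := (pos_iff_pos_of_mul_pos (this ▸ sub_pos.2 hγ)).1 hQ0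
    linarith
  obtain ⟨η, hη, hP⟩ : ∃ η : ℝ, 0 < η ∧ ∀ b, (b = a - η * D ∨ b = a + η * D) →
      (0 < b ∧ b < 1) ∧ 0 < S b ∧ b / p + (1 - b) / q < 1 / r ∧
        γ < b * (α - 1) + (1 - b) * β := by
    have hev : ∀ᶠ b in nhds a, (0 < b ∧ b < 1) ∧ 0 < S b ∧ b / p + (1 - b) / q < 1 / r ∧
        γ < b * (α - 1) + (1 - b) * β := by
      have c1 : ContinuousAt S a := by fun_prop
      have c2 : ContinuousAt (fun b => b / p + (1 - b) / q) a := by fun_prop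
      have c3 : ContinuousAt (fun b => b * (α - 1) + (1 - b) * β) a := by fun_prop
      filter_upwards [eventually_gt_nhds ha0, eventually_lt_nhds ha1, c1.eventually_const_lt hSa,
        c2.eventually_lt_const hra, c3.eventually_const_lt hγ] with b h1 h2 h3 h4 h5
      exact ⟨⟨h1, h2⟩, h3, h4, h5⟩
    have t1 : Filter.Tendsto (fun η : ℝ => a - η * D) (nhdsWithin 0 (Set.Ioi 0)) (nhds a) :=
      tendsto_nhdsWithin_of_tendsto_nhds (Continuous.tendsto' (by fun_prop) _ _ (by simp))
    have t2 : Filter.Tendsto (fun η : ℝ => a + η * D) (nhdsWithin 0 (Set.Ioi 0)) (nhds a) :=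
      tendsto_nhdsWithin_of_tendsto_nhds (Continuous.tendsto' (by fun_prop) _ _ (by simp))
    obtain ⟨η, h1, h2, h3⟩ :=
      ((t1.eventually hev).and ((t2.eventually hev).and self_mem_nhdsWithin)).exists
    exact ⟨η, h3, by rintro b (rfl | rfl); exacts [h1, h2]⟩
  have hSe : ∀ b, Q / r + γ - (b * (Q / p + (α - 1)) + (1 - b) * (Q / q + β)) = (a - b) * D := by
    intro b
    rw [hbal, hDdef]
    ring
  obtain ⟨⟨h11, h12⟩, h13, h14, h15⟩ := hP _ (Or.inl rfl)
  obtain ⟨⟨h21, h22⟩, h23, h24, h25⟩ := hP _ (Or.inr rfl)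
  set a₁ := a - η * D with ha₁
  set a₂ := a + η * D with ha₂
  have he1 : 0 < (a - a₁) * D := by
    rw [ha₁, sub_sub_cancel, mul_assoc]; positivity
  have he2 : (a - a₂) * D < 0 := by
    rw [ha₂, sub_add_cancel_left, neg_mul, mul_assoc, neg_lt_zero]; positivity
  obtain ⟨C₁, hC₁, H₁⟩ := exists_setLIntegral_le_of_interpolation hd hk hμ hQ hp hpQ hq hr hβ
    h11 h12 h13 h14 h15 measurableSet_Iio (T := Set.Iio 1) (fun s t hs ht => by
      rw [hSe] at ht
      exact setLIntegral_wt_Iio_lt_top hd hμ hQ hs ((pos_iff_pos_of_mul_pos ht).2 he1))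
    (by rw [hSe]; exact he1.ne')
  obtain ⟨C₂, hC₂, H₂⟩ := exists_setLIntegral_le_of_interpolation hd hk hμ hQ hp hpQ hq hr hβ
    h21 h22 h23 h24 h25 measurableSet_Ici (T := Set.Ici 1) (fun s t hs ht => by
      rw [hSe] at ht
      exact setLIntegral_wt_Ici_lt_top hd hμ hQ hs ((neg_iff_neg_of_mul_pos ht).2 he2))
    (by rw [hSe]; exact he2.ne)
  have hr1 : 0 ≤ 1 / r := by positivity
  refine ⟨2 ^ (1 / r) * C₁ + 2 ^ (1 / r) * C₂, by finiteness, fun u hu huc => ?_⟩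
  have hI : wint μ 0 α p (gradMuNorm μ u) ≠ ∞ :=
    (lintegral_wt_mul_rpow_lt_top hd hμ hQ hp0 (by simpa using by omega) (by linarith)
      (continuous_gradMuNorm hμ hu) (hasCompactSupport_gradMuNorm hu huc)).ne
  have hJ : wint μ (α - β) β q u ≠ ∞ :=
    (lintegral_wt_mul_rpow_lt_top hd hμ hQ hq0 (by rw [← mul_assoc]; exact hβ) (by linarith)
      hu.continuous huc).ne
  have key := le_mul_rpow_of_forall_scale (L := wint μ (α - γ) γ r u ^ (1 / r))
    (K₁ := 2 ^ (1 / r) * C₁) (K₂ := 2 ^ (1 / r) * C₂)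
    (A := wint μ 0 α p (gradMuNorm μ u) ^ (1 / p)) (B := wint μ (α - β) β q u ^ (1 / q)) (a := a)
    (ENNReal.rpow_ne_top_of_nonneg (by positivity) hI)
    (ENNReal.rpow_ne_top_of_nonneg (by positivity) hJ) h11 h12 h21 h22 hD ?_
  · rwa [← ENNReal.rpow_mul, ← ENNReal.rpow_mul, show 1 / p * a = a / p by ring,
      show 1 / q * (1 - a) = (1 - a) / q by ring, ← mul_assoc] at key
  intro R hR
  have k1 := H₁ u hu huc R hR
  have k2 := H₂ u hu huc R hR
  rw [hSe] at k1 k2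
  have hm : MeasurableSet {z : GSpace d k | R⁻¹ * grho μ z ∈ Set.Iio 1} :=
    ((continuous_grho (d := d) (k := k) hμ).measurable.const_mul R⁻¹) measurableSet_Iio
  have hc : {z : GSpace d k | R⁻¹ * grho μ z ∈ Set.Iio 1}ᶜ =
      {z : GSpace d k | R⁻¹ * grho μ z ∈ Set.Ici 1} := by
    ext z
    exact not_lt (a := R⁻¹ * grho μ z) (b := 1)
  have hsplit := lintegral_add_compl
    (fun z : GSpace d k => ENNReal.ofReal (wt μ (α - γ) γ z * |u z|) ^ r) hm (μ := volume)
  rw [hc] at hsplit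
  refine (ENNReal.rpow_le_two_rpow_mul_add hsplit.ge hr1).trans ?_
  rw [mul_add, mul_assoc (2 ^ (1 / r)) C₁, mul_assoc (2 ^ (1 / r)) C₂]
  exact add_le_add (mul_le_mul_right k1 _) (mul_le_mul_right k2 _)

lemma exists_wint_le (hd : 1 ≤ d) (hk : 1 ≤ k) (hμ : 0 < μ) {Q : ℝ}
    (hQ : Q = d + (1 + μ) * k) {p q r a α β σ γ : ℝ} (hγ : γ = a * σ + (1 - a) * β)
    (hp : 1 < p) (hpQ : p < Q) (hq : 1 ≤ q) (hr : 0 < r)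
    (h1 : 0 < d + μ * (α - γ) * r) (h2 : 0 < d + μ * (α - β) * q)
    (h3 : 0 < α * p + Q) (h4 : 0 < β * q + Q) (h5 : 0 < γ * r + Q)
    (ha0 : 0 ≤ a) (ha1 : a ≤ 1)
    (hbal : 1 / r + γ / Q = a * (1 / p + (α - 1) / Q) + (1 - a) * (1 / q + β / Q))
    (hσα : 0 < a → σ ≤ α)
    (hbd : 0 < a → 1 / p + (α - 1) / Q = 1 / r + γ / Q → α - σ ≤ 1) :
    ∃ C : ℝ≥0∞, C ≠ ∞ ∧ ∀ u : GSpace d k → ℝ, ContDiff ℝ 1 u → HasCompactSupport u →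
      wint μ (α - γ) γ r u ^ (1 / r) ≤
        C * wint μ 0 α p (gradMuNorm μ u) ^ (a / p) * wint μ (α - β) β q u ^ ((1 - a) / q) := by
  have hQ0 : 0 < Q := by linarith
  have hfin : ∀ u : GSpace d k → ℝ, ContDiff ℝ 1 u → HasCompactSupport u →
      wint μ (α - γ) γ r u ≠ ∞ := fun u hu huc =>
    (lintegral_wt_mul_rpow_lt_top hd hμ hQ hr (by rw [← mul_assoc]; exact h1) (by linarith)
      hu.continuous huc).ne
  rcases le_or_gt (a * (α - σ)) a with hle | hlt
  · have hθ : 0 ≤ a * (α - σ) := by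
      rcases ha0.eq_or_lt with h | h
      · simp [← h]
      · exact mul_nonneg ha0 (sub_nonneg.2 (hσα h))
    obtain ⟨C, hC, H⟩ := exists_wint_le_of_convex hd hk hμ hQ (γ := γ) (r := r) (α := α) (β := β)
      (θ₁ := a * (α - σ)) (θ₂ := a - a * (α - σ)) (θ₃ := 1 - a) hp hpQ hq hr hθ
      (sub_nonneg.2 hle) (sub_nonneg.2 ha1) (by ring) (by rw [hγ]; ring)
      (by
        rw [hγ] at hbal
        linear_combination hbal) (by linarith)
    refine ⟨C, hC, fun u hu huc => ?_⟩
    have := H u hu huc (hfin u hu huc)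
    rwa [add_sub_cancel] at this
  · have ha : 0 < a := by
      refine ha0.lt_of_ne fun h => ?_
      simp [← h] at hlt
    have hσ : 1 < α - σ := by
      by_contra! h
      nlinarith
    have hne : ¬ 1 / p + (α - 1) / Q = 1 / r + γ / Q := fun h => not_le.2 hσ (hbd ha h)
    have ha' : a < 1 := by
      refine ha1.lt_of_ne fun h => hne ?_
      rw [hbal, h]
      ring
    have hbal' : Q / r + γ = a * (Q / p + (α - 1)) + (1 - a) * (Q / q + β) := by
      have := congrArg (Q * ·) hbal
      field_simp at this ⊢
      linear_combination this
    refine exists_wint_le_of_interpolation hd hk hμ hQ hp hpQ hq hr h2 h3 h4 h5 ha ha' hbal'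
      (by rw [hγ]; linarith) fun h => hne ?_
    have e1 : 1 / r + γ / Q = (Q / r + γ) / Q := by field_simp
    have e2 : 1 / p + (α - 1) / Q = (Q / p + (α - 1)) / Q := by field_simp
    rw [e1, e2, hbal', sub_eq_zero.1 h]
    ring

lemma wint_toReal (hμ : 0 < μ) {s t r : ℝ} (hr : 0 < r) {f : GSpace d k → ℝ} (hf : Continuous f) :
    (wint μ s t r f).toReal =
      ∫ z, (‖z.1‖ ^ μ / grho μ z ^ μ) ^ (s * r) * grho μ z ^ (t * r) * |f z| ^ r := by
  have h : ∀ z : GSpace d k,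
      (‖z.1‖ ^ μ / grho μ z ^ μ) ^ (s * r) * grho μ z ^ (t * r) * |f z| ^ r =
        (wt μ s t z * |f z|) ^ r := by
    intro z
    rw [mul_rpow (wt_nonneg _ _ _) (abs_nonneg _), wt_rpow]
    rfl
  have hm : Measurable fun z : GSpace d k => (wt μ s t z * |f z|) ^ r :=
    ((measurable_wt hμ s t).mul hf.abs.measurable).pow_const r
  have hn : ∀ z : GSpace d k, 0 ≤ wt μ s t z * |f z| := fun z =>
    mul_nonneg (wt_nonneg _ _ _) (abs_nonneg _)
  simp_rw [h]
  rw [integral_eq_lintegral_of_nonneg_ae (Filter.Eventually.of_forall fun z => rpow_nonneg (hn z) _)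
    hm.aestronglyMeasurable, wint]
  congr 1
  exact lintegral_congr fun z => ENNReal.ofReal_rpow_of_nonneg (hn z) hr.le

end Final

/-- Weighted Caffarelli–Kohn–Nirenberg inequality for the Grushin gradient: sufficiency. -/
theorem weighted_CKN_grushin_sufficiency
    (d k : ℕ) (hd : 1 ≤ d) (hk : 1 ≤ k) (μ : ℝ) (hμ : 0 < μ)
    (Q : ℝ) (hQ : Q = d + (1 + μ) * k)
    (p q r a α β σ γ : ℝ)
    (hγ : γ = a * σ + (1 - a) * β)
    (hp1 : 1 < p) (hpQ : p < Q) (hq : 1 ≤ q) (hr : 0 < r)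
    (h1 : 0 < d + μ * (α - γ) * r) (h2 : 0 < d + μ * (α - β) * q)
    (h3 : 0 < α * p + Q) (h4 : 0 < β * q + Q) (h5 : 0 < γ * r + Q)
    (ha0 : 0 ≤ a) (ha1 : a ≤ 1)
    (hbal : 1 / r + γ / Q = a * (1 / p + (α - 1) / Q) + (1 - a) * (1 / q + β / Q))
    (hσα : 0 < a → σ ≤ α)
    (hbd : 0 < a → 1 / p + (α - 1) / Q = 1 / r + γ / Q → α - σ ≤ 1) :
    ∃ C : ℝ, 0 < C ∧
      ∀ u : EuclideanSpace ℝ (Fin d) × EuclideanSpace ℝ (Fin k) → ℝ,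
        ContDiff ℝ (⊤ : ℕ∞) u → HasCompactSupport u →
        (∫ z, (‖z.1‖ ^ μ / grho μ z ^ μ) ^ ((α - γ) * r) * grho μ z ^ (γ * r) * |u z| ^ r) ^ (1 / r)
          ≤ C * (∫ z, grho μ z ^ (α * p) * gradMuNorm μ u z ^ p) ^ (a / p) *
              (∫ z, (‖z.1‖ ^ μ / grho μ z ^ μ) ^ ((α - β) * q) * grho μ z ^ (β * q) * |u z| ^ q) ^
                ((1 - a) / q) := by
  have hp0 : 0 < p := by linarith
  have hq0 : 0 < q := by linarith
  obtain ⟨C, hC, H⟩ := exists_wint_le hd hk hμ hQ hγ hp1 hpQ hq hr h1 h2 h3 h4 h5 ha0 ha1 hbal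
    hσα hbd
  refine ⟨C.toReal + 1, by positivity, fun u hu huc => ?_⟩
  have hu1 : ContDiff ℝ 1 u := hu.of_le (by exact_mod_cast le_top)
  have hI : wint μ 0 α p (gradMuNorm μ u) ≠ ∞ :=
    (lintegral_wt_mul_rpow_lt_top hd hμ hQ hp0 (by simpa using by omega) (by linarith)
      (continuous_gradMuNorm hμ hu1) (hasCompactSupport_gradMuNorm hu1 huc)).ne
  have hJ : wint μ (α - β) β q u ≠ ∞ :=
    (lintegral_wt_mul_rpow_lt_top hd hμ hQ hq0 (by rw [← mul_assoc]; exact h2) (by linarith)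
      hu.continuous huc).ne
  have eG : (wint μ 0 α p (gradMuNorm μ u)).toReal =
      ∫ z, grho μ z ^ (α * p) * gradMuNorm μ u z ^ p := by
    rw [wint_toReal hμ hp0 (continuous_gradMuNorm hμ hu1)]
    simp only [zero_mul, rpow_zero, one_mul, abs_of_nonneg (gradMuNorm_nonneg _ _)]
  rw [← eG, ← wint_toReal hμ hr hu.continuous, ← wint_toReal hμ hq0 hu.continuous]
  have h := ENNReal.toReal_mono (by
    have e1 : 0 ≤ a / p := by positivity
    have e2 : 0 ≤ (1 - a) / q := div_nonneg (sub_nonneg.2 ha1) hq0.le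
    finiteness) (H u hu1 huc)
  rw [ENNReal.toReal_mul, ENNReal.toReal_mul, ← ENNReal.toReal_rpow, ← ENNReal.toReal_rpow,
    ← ENNReal.toReal_rpow] at h
  refine h.trans ?_
  gcongr
  linarith
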